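/- arXiv:1102.3904 — 9 statements merged into one kernel-verified Lean document; each statement's English description precedes it below -/
import Mathlib

section
/- Let k*, k** ∈ ℕ and let G be a finite graph with the non-k*-order property and the non-k**-tree property. Suppose: (1) ε_1, ε_3 are reals with 0 < ε_3 < ε_2 := ε_1/3 < ε_1 < 1/2^{k**}; (2) ⟨m_ℓ : ℓ < k**⟩ is a sequence of positive integers such that m_{ℓ+1} < ε_3·m_ℓ for each ℓ < k**−1, m_{**} := m_{k**−1} divides m_ℓ for each ℓ < k**, log log m_0 ≤ m_{**}, and m_{**} ≥ max(k**, 1/ε_2); (3) N ∈ ℕ is such that for every r ≤ m_0/m_{**} and every ε_3-excellent B ⊆ G with |B| > N and r dividing |B|, B can be partitioned into r pieces of equal size each of which is ε_2-excellent, and moreover m_{k**−2} > N; (4) A ⊆ G with |A| = n and m_0 ≤ (ε_2·n + 1)/(1 + ε_2). Then there exist i(*) ≤ n/m_{**} and a partition ⟨A_i : i < i(*)⟩ of A such that: for all i < j < i(*), ||A_i| − |A_j|| ≤ 1; each A_i is ε_1-excellent; and every pair (A_i, A_j) with i ≠ j is (ε_1, ε_1)-uniform. -/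
open Finset

open scoped Classical

namespace Paper

variable {V : Type}

/-- `G` has the `k`-order property. -/
def HasOrderProp (G : SimpleGraph V) (k : ℕ) : Prop :=
  ∃ a b : Fin k → V, ∀ i j : Fin k, i < j → G.Adj (a i) (b j) ∧ ¬ G.Adj (a j) (b i)

/-- `G` has the non-`k`-order property. -/
def NoOrderProp (G : SimpleGraph V) (k : ℕ) : Prop := ¬ HasOrderProp G k

/-- `G` has the non-`k`-tree property. -/
def NoTreeProp (G : SimpleGraph V) (k : ℕ) : Prop :=
  ¬ ∃ (a : (Fin k → Bool) → V) (b : (m : Fin k) → (Fin (m : ℕ) → Bool) → V),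
      ∀ (η : Fin k → Bool) (m : Fin k) (ρ : Fin (m : ℕ) → Bool),
        (∀ i : Fin (m : ℕ), η ⟨i.1, i.2.trans m.2⟩ = ρ i) →
        (G.Adj (a η) (b m ρ) ↔ η m = true)

/-- The truth value `t` is the `ζ`-average of the vertex `a` over the set `B`:
all but fewer than `ζ|B|` of the `b ∈ B` satisfy `(a R b) ≡ t`. -/
def AvgIs (G : SimpleGraph V) (ζ : ℝ) (B : Finset V) (a : V) (t : Bool) : Prop :=
  ((B.filter fun b => ¬ (G.Adj a b ↔ t = true)).card : ℝ) < ζ * B.card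

/-- `A` is `ε`-good. -/
def Good (G : SimpleGraph V) (ε : ℝ) (A : Finset V) : Prop :=
  ∀ b : V, ∃ t : Bool, AvgIs G ε A b t

/-- `A` is `(ε,ζ)`-excellent. -/
def Excellent (G : SimpleGraph V) (ε ζ : ℝ) (A : Finset V) : Prop :=
  Good G ε A ∧
    ∀ B : Finset V, Good G ζ B →
      ∃ t : Bool, ((A.filter fun a => ¬ AvgIs G ζ B a t).card : ℝ) < ε * A.card

/-- The pair `(A,B)` is `(ε,ζ)`-uniform. -/
def Uniform (G : SimpleGraph V) (ε ζ : ℝ) (A B : Finset V) : Prop :=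
  ∃ t : Bool, ((A.filter fun a => ¬ AvgIs G ζ B a t).card : ℝ) < ε * A.card

/-- `A` is `f`-indivisible. -/
def Indivisible (G : SimpleGraph V) (f : ℕ → ℕ) (A : Finset V) : Prop :=
  ∀ b : V, ∃ t : Bool, (A.filter fun a => ¬ (G.Adj a b ↔ t = true)).card < f A.card

/-- `A` is `ε`-indivisible, for a real `ε ∈ (0,1)`. -/
def EpsIndivisible (G : SimpleGraph V) (ε : ℝ) (A : Finset V) : Prop :=
  ∀ b : V, ∃ t : Bool,
    ((A.filter fun a => ¬ (G.Adj a b ↔ t = true)).card : ℝ) < (A.card : ℝ) ^ ε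

/-- The edge density between `A` and `B`. -/
noncomputable def density (G : SimpleGraph V) (A B : Finset V) : ℝ :=
  (((A ×ˢ B).filter fun p => G.Adj p.1 p.2).card : ℝ) / (A.card * B.card)

/-- The pair `(A,B)` is `ε`-regular. -/
def Regular (G : SimpleGraph V) (ε : ℝ) (A B : Finset V) : Prop :=
  ∀ A' ⊆ A, ∀ B' ⊆ B, ε * A.card ≤ (A'.card : ℝ) → ε * B.card ≤ (B'.card : ℝ) →
    |density G A B - density G A' B'| < ε

/-- The sequence `⟨a_i : i < n⟩` is `Δ_k`-indiscernible. -/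
def DeltaIndiscernible (G : SimpleGraph V) (k : ℕ) {n : ℕ} (a : Fin n → V) : Prop :=
  Function.Injective a ∧
  (∀ i₀ i₁ j₀ j₁ : Fin n, i₀ < i₁ → j₀ < j₁ →
    (G.Adj (a i₀) (a i₁) ↔ G.Adj (a j₀) (a j₁))) ∧
  (∀ m : ℕ, m ≤ k → ∀ i j : Fin k → Fin n, StrictMono i → StrictMono j →
    (((∃ y : V, (∀ ℓ : Fin k, (ℓ : ℕ) < m → G.Adj y (a (i ℓ))) ∧
                (∀ ℓ : Fin k, m ≤ (ℓ : ℕ) → ¬ G.Adj y (a (i ℓ)))) ↔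
      (∃ y : V, (∀ ℓ : Fin k, (ℓ : ℕ) < m → G.Adj y (a (j ℓ))) ∧
                (∀ ℓ : Fin k, m ≤ (ℓ : ℕ) → ¬ G.Adj y (a (j ℓ))))) ∧
     ((∃ y : V, (∀ ℓ : Fin k, (ℓ : ℕ) < m → ¬ G.Adj y (a (i ℓ))) ∧
                (∀ ℓ : Fin k, m ≤ (ℓ : ℕ) → G.Adj y (a (i ℓ)))) ↔
      (∃ y : V, (∀ ℓ : Fin k, (ℓ : ℕ) < m → ¬ G.Adj y (a (j ℓ))) ∧
                (∀ ℓ : Fin k, m ≤ (ℓ : ℕ) → G.Adj y (a (j ℓ)))))))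

end Paper

open Paper

namespace Paper

variable {V : Type}

lemma Good.nonempty [Nonempty V] {G : SimpleGraph V} {ζ : ℝ} {B : Finset V}
    (hB : Good G ζ B) : B.Nonempty := by
  obtain ⟨v⟩ := ‹Nonempty V›
  obtain ⟨t, ht⟩ := hB v
  rw [Finset.nonempty_iff_ne_empty]
  rintro rfl
  simp [AvgIs] at ht

lemma Good.avgIs_of_not {G : SimpleGraph V} {ζ : ℝ} {B : Finset V} (hB : Good G ζ B) {a : V}
    {t : Bool} (h : ¬ AvgIs G ζ B a t) : AvgIs G ζ B a (!t) := by
  obtain ⟨s, hs⟩ := hB a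
  cases s <;> cases t <;> simp_all

lemma good_singleton (G : SimpleGraph V) {ζ : ℝ} (hζ : 0 < ζ) (b : V) : Good G ζ {b} := by
  intro a
  refine ⟨decide (G.Adj a b), ?_⟩
  simp [AvgIs, Finset.filter_singleton, hζ]

lemma avgIs_singleton {G : SimpleGraph V} {ζ : ℝ} {a b : V} {t : Bool} (hζ : 0 < ζ)
    (h : G.Adj a b ↔ t = true) : AvgIs G ζ {b} a t := by
  simp [AvgIs, Finset.filter_singleton, h, hζ]

/-- A set which is not excellent is split by some good set into two parts, neither of which is
small. -/
lemma exists_good_split {G : SimpleGraph V} {ε : ℝ} (hε : 0 < ε) {X : Finset V}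
    (hX : ¬ Excellent G ε ε X) :
    ∃ D : Finset V, Good G ε D ∧
      ∀ t : Bool, ε * X.card ≤ ((X.filter fun a => AvgIs G ε D a t).card : ℝ) := by
  by_cases hg : Good G ε X
  · simp only [Excellent, hg, true_and] at hX
    push Not at hX
    obtain ⟨D, hD, h⟩ := hX
    refine ⟨D, hD, fun t => (h (!t)).trans ?_⟩
    norm_cast
    refine Finset.card_le_card fun a ha => ?_
    simp only [Finset.mem_filter] at ha ⊢
    exact ⟨ha.1, by simpa using hD.avgIs_of_not ha.2⟩
  · simp only [Good, AvgIs] at hg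
    push Not at hg
    obtain ⟨b, h⟩ := hg
    refine ⟨{b}, good_singleton G hε b, fun t => (h (!t)).trans ?_⟩
    norm_cast
    refine Finset.card_le_card fun a ha => ?_
    simp only [Finset.mem_filter] at ha ⊢
    refine ⟨ha.1, avgIs_singleton hε ?_⟩
    have h2 := ha.2
    rw [G.adj_comm] at h2
    cases t <;> simp_all

/-- If no subset of `A` whose size is in the sequence `m` is excellent, then iterated splitting
produces a tree of good sets. -/
lemma exists_tree_of_good {G : SimpleGraph V} {ε : ℝ} (hε : 0 < ε) {k : ℕ} {m : ℕ → ℕ}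
    (hpos : ∀ ℓ, ℓ < k → 0 < m ℓ) (hdec : ∀ ℓ, ℓ + 1 < k → (m (ℓ + 1) : ℝ) < ε * m ℓ)
    {A : Finset V}
    (hA : ∀ ℓ < k, ∀ X ⊆ A, X.card = m ℓ → ¬ Excellent G ε ε X) :
    ∀ j ≤ k, ∀ X ⊆ A, X.Nonempty → (j ≠ 0 → m (k - j) ≤ X.card) →
      ∃ (a : List Bool → V) (B : List Bool → Finset V),
        (∀ η, a η ∈ X) ∧ (∀ ρ, ρ.length < j → Good G ε (B ρ)) ∧
        ∀ η ρ t, η.length = j → ρ ++ [t] <+: η → AvgIs G ε (B ρ) (a η) t := by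
  intro j
  induction j with
  | zero =>
    rintro - X - ⟨x, hx⟩ -
    refine ⟨fun _ => x, fun _ => ∅, fun _ => hx, by simp, fun η ρ t hη hρ => ?_⟩
    have := hρ.length_le
    simp [hη] at this
  | succ j ih =>
    intro hj X hXA _ hcard
    obtain ⟨X', hX'X, hX'⟩ := Finset.exists_subset_card_eq (hcard (by simp))
    obtain ⟨D, hD, hsplit⟩ :=
      exists_good_split hε (hA (k - (j + 1)) (by omega) X' (hX'X.trans hXA) hX')
    have hm := hpos (k - (j + 1)) (by omega)
    have key : ∀ t : Bool, ∃ (a : List Bool → V) (B : List Bool → Finset V),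
        (∀ ρ, ρ.length < j → Good G ε (B ρ)) ∧
        (∀ η ρ s, η.length = j → ρ ++ [s] <+: η → AvgIs G ε (B ρ) (a η) s) ∧
        ∀ η, a η ∈ X' ∧ AvgIs G ε D (a η) t := by
      intro t
      have hpart := hsplit t
      rw [hX'] at hpart
      set Y := X'.filter fun a => AvgIs G ε D a t with hY
      have hYpos : (0 : ℝ) < Y.card :=
        lt_of_lt_of_le (mul_pos hε (by exact_mod_cast hm)) hpart
      obtain ⟨a, B, haY, hB, ha⟩ := ih (by omega) Y
        ((Finset.filter_subset _ _).trans (hX'X.trans hXA))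
        (Finset.card_pos.1 (by exact_mod_cast hYpos)) (fun hj0 => by
          have h := hdec (k - (j + 1)) (by omega)
          rw [show k - (j + 1) + 1 = k - j by omega] at h
          exact_mod_cast (h.trans_le hpart).le)
      exact ⟨a, B, hB, ha, fun η => Finset.mem_filter.1 (haY η)⟩
    choose a B hB ha haD using key
    refine ⟨fun η => match η with
        | [] => a true []
        | t :: η => a t η,
      fun ρ => match ρ with
        | [] => D
        | t :: ρ => B t ρ, ?_, ?_, ?_⟩
    · rintro (_ | ⟨t, η⟩)
      · exact hX'X (haD true []).1
      · exact hX'X (haD t η).1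
    · rintro (_ | ⟨t, ρ⟩) hρ
      · exact hD
      · exact hB t ρ (by simpa using hρ)
    · rintro (_ | ⟨s, η⟩) (_ | ⟨r, ρ⟩) t hη hρ
      · simp at hη
      · simp at hη
      · simp at hρ
        subst hρ
        exact (haD _ _).2
      · simp only [List.cons_append, List.cons_prefix_cons] at hρ
        obtain ⟨rfl, hρ⟩ := hρ
        exact ha _ _ _ _ (by simpa using hη) hρ

lemma exists_excellent_subset {G : SimpleGraph V} {ε : ℝ} {k : ℕ} (hG : NoTreeProp G k)
    (hε : 0 < ε) (hεk : ε < 1 / 2 ^ k) {m : ℕ → ℕ} (hk : 0 < k)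
    (hpos : ∀ ℓ, ℓ < k → 0 < m ℓ) (hdec : ∀ ℓ, ℓ + 1 < k → (m (ℓ + 1) : ℝ) < ε * m ℓ)
    {A : Finset V} (hA : m 0 ≤ A.card) :
    ∃ ℓ < k, ∃ X ⊆ A, X.card = m ℓ ∧ Excellent G ε ε X := by
  by_contra! hcon
  have hne : A.Nonempty := Finset.card_pos.1 ((hpos 0 hk).trans_le hA)
  obtain ⟨v, -⟩ := id hne
  have : Nonempty V := ⟨v⟩
  obtain ⟨a, B, -, hB, ha⟩ := exists_tree_of_good hε hpos hdec hcon k le_rfl A subset_rfl hne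
    (by simpa using fun _ => hA)
  have key : ∀ ρ : List Bool, ρ.length < k → ∃ b : V, ∀ (η : Fin k → Bool) (t : Bool),
      ρ ++ [t] <+: List.ofFn η → (G.Adj (a (List.ofFn η)) b ↔ t = true) := by
    intro ρ hρ
    by_contra! hb
    have hcover : B ρ ⊆ (Finset.univ : Finset (Fin k → Bool)).biUnion fun η =>
        (B ρ).filter fun b => ∃ t, ρ ++ [t] <+: List.ofFn η ∧
          ¬ (G.Adj (a (List.ofFn η)) b ↔ t = true) := by
      intro b hbB
      obtain ⟨η, t, h, h'⟩ := hb b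
      simp only [Finset.mem_biUnion, Finset.mem_univ, true_and, Finset.mem_filter]
      exact ⟨η, hbB, t, h, by tauto⟩
    have hle : ∀ η : Fin k → Bool, (((B ρ).filter fun b => ∃ t, ρ ++ [t] <+: List.ofFn η ∧
          ¬ (G.Adj (a (List.ofFn η)) b ↔ t = true)).card : ℝ) ≤ ε * (B ρ).card := by
      intro η
      by_cases hη : ∃ t, ρ ++ [t] <+: List.ofFn η
      · obtain ⟨t, ht⟩ := hη
        refine le_trans ?_ (ha _ ρ t (by simp) ht).le
        norm_cast
        refine Finset.card_le_card fun b hb => ?_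
        simp only [Finset.mem_filter] at hb ⊢
        obtain ⟨hbB, s, hs, h⟩ := hb
        have hst : ρ ++ [s] = ρ ++ [t] :=
          (List.prefix_of_prefix_length_le hs ht (by simp)).eq_of_length (by simp)
        obtain rfl : s = t := by simpa using hst
        exact ⟨hbB, h⟩
      · push Not at hη
        simp only [hη, false_and, exists_false, Finset.filter_false, Finset.card_empty,
          Nat.cast_zero]
        positivity
    have hsum : ((B ρ).card : ℝ) ≤ 2 ^ k * (ε * (B ρ).card) := by
      have hnat := (Finset.card_le_card hcover).trans Finset.card_biUnion_le
      rw [← Nat.cast_le (α := ℝ)] at hnat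
      calc ((B ρ).card : ℝ) ≤ _ := hnat
        _ ≤ ∑ _η : Fin k → Bool, ε * ((B ρ).card : ℝ) := by
            push_cast
            exact Finset.sum_le_sum fun η _ => hle η
        _ = _ := by simp
    have hcard : (0 : ℝ) < (B ρ).card := by
      exact_mod_cast (hB ρ hρ).nonempty.card_pos
    have h1 : 2 ^ k * ε < 1 := by
      rwa [lt_div_iff₀ (by positivity), mul_comm] at hεk
    nlinarith
  choose! b hb using key
  refine hG ⟨fun η => a (List.ofFn η), fun i ρ => b (List.ofFn ρ), fun η i ρ h => ?_⟩
  refine hb (List.ofFn ρ) (by simp) η (η i) ?_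
  rw [List.prefix_iff_eq_take]
  apply List.ext_getElem
  · simp
  · intro n h1 h2
    simp only [List.length_append, List.length_ofFn, List.length_singleton] at h1
    simp only [List.getElem_take, List.getElem_ofFn, List.getElem_append, List.length_ofFn]
    split_ifs with hn
    · exact (h ⟨n, hn⟩).symm
    · obtain rfl : n = i := by omega
      simp

/-- A set obtained by adding at most `e + 1` points to a set on which every vertex has at most `e`
exceptions is excellent. The truth values `t(a,D)` for good `D` are controlled by double counting. -/
lemma excellent_of_good_core {G : SimpleGraph V} {ε : ℝ} (hε : ε ≤ 1 / 4)
    {Q P : Finset V} {e : ℕ} (hQP : Q ⊆ P)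
    (hQ : ∀ b, ∃ t : Bool, (Q.filter fun a => ¬ (G.Adj b a ↔ t = true)).card ≤ e)
    (hR : (P \ Q).card ≤ e + 1)
    (he : (3 * e : ℝ) < ε * P.card) (he' : (2 * e + 1 : ℝ) < ε * P.card) :
    Excellent G ε ε P := by
  have hfilter : ∀ (p : V → Prop) [DecidablePred p], (P.filter p).card ≤ (Q.filter p).card + (e + 1) := by
    intro p _
    refine le_trans (Finset.card_le_card (t := Q.filter p ∪ P \ Q) fun x hx => ?_)
      ((Finset.card_union_le _ _).trans (by omega))
    simp only [Finset.mem_filter, Finset.mem_union, Finset.mem_sdiff] at hx ⊢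
    tauto
  refine ⟨fun b => ?_, fun D hD => ?_⟩
  · obtain ⟨t, ht⟩ := hQ b
    refine ⟨t, lt_of_le_of_lt ?_ he'⟩
    have := hfilter fun a => ¬ (G.Adj b a ↔ t = true)
    norm_cast
    omega
  by_contra! hcon
  have hP : P.Nonempty := by
    rw [Finset.nonempty_iff_ne_empty]
    rintro rfl
    simp at he
    linarith [Nat.cast_nonneg (α := ℝ) e]
  obtain ⟨v, -⟩ := id hP
  have : Nonempty V := ⟨v⟩
  have hDpos : (0 : ℝ) < D.card := by exact_mod_cast hD.nonempty.card_pos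
  let E : Bool → Finset V := fun t =>
    D.filter fun d => (Q.filter fun a => ¬ (G.Adj d a ↔ t = true)).card ≤ e
  have hE : ∀ t, 2 * ((E t).card : ℝ) < D.card := by
    intro t
    set X := Q.filter fun a => ¬ AvgIs G ε D a t with hX
    have hXcard : ε * P.card ≤ (X.card + (e + 1) : ℝ) :=
      (hcon t).trans (by exact_mod_cast hfilter _)
    have hX2 : 2 * e ≤ X.card := by
      have : ((3 * e : ℕ) : ℝ) < ((X.card + (e + 1) : ℕ) : ℝ) := by
        push_cast; linarith
      have := Nat.cast_lt.1 this
      omega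
    have hXpos : 0 < X.card := by
      have : ((2 * e + 1 : ℕ) : ℝ) < ((X.card + (e + 1) : ℕ) : ℝ) := by
        push_cast; linarith
      have := Nat.cast_lt.1 this
      omega
    let r : V → V → Prop := fun a d => G.Adj a d ↔ t = true
    have hdc := Finset.sum_card_bipartiteAbove_eq_sum_card_bipartiteBelow (s := X) (t := E t) r
    have hup : ∀ a ∈ X, ((Finset.bipartiteAbove r (E t) a).card : ℝ) < ε * D.card := by
      intro a ha
      have h := hD.avgIs_of_not (Finset.mem_filter.1 ha).2
      refine lt_of_le_of_lt ?_ h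
      norm_cast
      refine Finset.card_le_card fun d hd => ?_
      simp only [Finset.bipartiteAbove, E, Finset.mem_filter, r] at hd ⊢
      refine ⟨hd.1.1, ?_⟩
      rw [hd.2]
      cases t <;> simp
    have hdown : ∀ d ∈ E t, X.card ≤ 2 * (Finset.bipartiteBelow r X d).card := by
      intro d hd
      have h := (Finset.mem_filter.1 hd).2
      have hs := Finset.card_filter_add_card_filter_not (s := X) (fun a => r a d)
      have hle : (X.filter fun a => ¬ r a d).card ≤ e := by
        refine le_trans (Finset.card_le_card fun a ha => ?_) h
        simp only [hX, Finset.mem_filter, r] at ha ⊢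
        rw [G.adj_comm]
        exact ⟨ha.1.1, ha.2⟩
      simp only [Finset.bipartiteBelow]
      omega
    have h1 : ((E t).card : ℝ) * X.card ≤
        2 * ∑ d ∈ E t, ((Finset.bipartiteBelow r X d).card : ℝ) := by
      rw [Finset.mul_sum, ← nsmul_eq_mul, ← Finset.sum_const]
      exact Finset.sum_le_sum fun d hd => by exact_mod_cast hdown d hd
    have h2 : ∑ a ∈ X, ((Finset.bipartiteAbove r (E t) a).card : ℝ) <
        X.card * (ε * D.card) := by
      rw [← nsmul_eq_mul, ← Finset.sum_const]
      exact Finset.sum_lt_sum_of_nonempty (Finset.card_pos.1 hXpos) hup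
    have h3 : ∑ a ∈ X, ((Finset.bipartiteAbove r (E t) a).card : ℝ) =
        ∑ d ∈ E t, ((Finset.bipartiteBelow r X d).card : ℝ) := by exact_mod_cast hdc
    have hXp : (0 : ℝ) < X.card := by exact_mod_cast hXpos
    have h4 : ε * D.card ≤ 1 / 4 * D.card := by gcongr
    have h5 : (X.card : ℝ) * (ε * D.card) ≤ X.card * (1 / 4 * D.card) := by gcongr
    nlinarith
  have hcover : D ⊆ E false ∪ E true := by
    intro d hd
    obtain ⟨t, ht⟩ := hQ d
    have : d ∈ E t := Finset.mem_filter.2 ⟨hd, ht⟩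
    cases t <;> simp [this]
  have hle : (D.card : ℝ) ≤ (E false).card + (E true).card := by
    exact_mod_cast (Finset.card_le_card hcover).trans (Finset.card_union_le _ _)
  linarith [hE false, hE true]

lemma Excellent.uniform {G : SimpleGraph V} {ε : ℝ} {A B : Finset V}
    (hA : Excellent G ε ε A) (hB : Excellent G ε ε B) : Uniform G ε ε A B :=
  hA.2 B hB.1

/-- If every large subset of `A` contains a set with property `p` of size `c`, then `A` contains
many disjoint such sets. -/
lemma exists_disjoint_family {p : Finset V → Prop} {c M : ℕ} {A : Finset V}
    (h : ∀ X ⊆ A, M ≤ X.card → ∃ Q ⊆ X, Q.card = c ∧ p Q) :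
    ∀ s : ℕ, (s - 1) * c + M ≤ A.card → ∃ Q : Fin s → Finset V,
      (∀ i, Q i ⊆ A) ∧ (∀ i j, i ≠ j → Disjoint (Q i) (Q j)) ∧
      (∀ i, (Q i).card = c) ∧ ∀ i, p (Q i) := by
  intro s
  induction s with
  | zero => exact fun _ => ⟨fun i => i.elim0, fun i => i.elim0, fun i => i.elim0,
      fun i => i.elim0, fun i => i.elim0⟩
  | succ s ih =>
    intro hs
    simp only [Nat.add_sub_cancel] at hs
    obtain ⟨Q, hQA, hQd, hQc, hQp⟩ := ih (le_trans (by gcongr; omega) hs)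
    have hU : (Finset.univ.biUnion Q).card ≤ s * c := by
      refine Finset.card_biUnion_le.trans ?_
      simp [hQc]
    have hcard : M ≤ (A \ Finset.univ.biUnion Q).card := by
      have := Finset.le_card_sdiff (Finset.univ.biUnion Q) A
      omega
    obtain ⟨Q', hQ', hc, hp⟩ := h _ Finset.sdiff_subset hcard
    have hd : ∀ i, Disjoint Q' (Q i) := fun i =>
      Finset.disjoint_of_subset_left hQ' (Finset.disjoint_of_subset_right
        (Finset.subset_biUnion_of_mem Q (Finset.mem_univ i)) Finset.sdiff_disjoint)
    refine ⟨Fin.cons Q' Q, ?_, ?_, ?_, ?_⟩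
    · exact Fin.cases (hQ'.trans Finset.sdiff_subset) hQA
    · refine Fin.cases (Fin.cases (by simp) fun j _ => hd j) fun i =>
        Fin.cases (fun _ => (hd i).symm) fun j hij => hQd i j ?_
      rintro rfl
      exact hij rfl
    · exact Fin.cases hc hQc
    · exact Fin.cases hp hQp

lemma exists_equitable_family (R : Finset V) {s : ℕ} (hs : 0 < s) :
    ∃ T : Fin s → Finset V, (∀ i, T i ⊆ R) ∧ (∀ i j, i ≠ j → Disjoint (T i) (T j)) ∧
      (∀ a ∈ R, ∃ i, a ∈ T i) ∧
      ∀ i, R.card / s ≤ (T i).card ∧ (T i).card ≤ R.card / s + 1 := by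
  let f : V → ℕ := fun a => if h : a ∈ R then (R.equivFin ⟨a, h⟩ : ℕ) else 0
  have hinj : Set.InjOn f R := by
    intro a ha b hb hab
    simp only [Finset.mem_coe] at ha hb
    simp only [f, ha, hb, dif_pos] at hab
    simpa using R.equivFin.injective (Fin.ext hab)
  have himage : R.image f = Finset.range R.card := by
    refine Finset.eq_of_subset_of_card_le ?_ ?_
    · intro n hn
      obtain ⟨a, ha, rfl⟩ := Finset.mem_image.1 hn
      simp [f, ha]
    · rw [Finset.card_image_of_injOn hinj, Finset.card_range]
  have hcard : ∀ i : Fin s, (R.filter fun a => f a % s = i).card =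
      R.card / s + if (i : ℕ) % s < R.card % s then 1 else 0 := by
    intro i
    rw [← Nat.count_modEq_card _ hs, Nat.count_eq_card_filter_range, ← himage,
      Finset.filter_image, Finset.card_image_of_injOn
        (hinj.mono (by exact_mod_cast Finset.filter_subset _ _))]
    simp [Nat.ModEq, Nat.mod_eq_of_lt i.2]
  refine ⟨fun i => R.filter fun a => f a % s = i, fun i => Finset.filter_subset _ _, ?_, ?_, ?_⟩
  · intro i j hij
    rw [Finset.disjoint_filter]
    intro a _ hi hj
    exact hij (Fin.ext (hi.symm.trans hj))
  · exact fun a ha => ⟨⟨f a % s, Nat.mod_lt _ hs⟩, by simp [ha]⟩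
  · intro i
    simp only [hcard i]
    split_ifs <;> omega

lemma not_adj_of_noTreeProp_one {G : SimpleGraph V} (hG : NoTreeProp G 1) (x y : V) :
    ¬ G.Adj x y := by
  intro h
  refine hG ⟨fun η => if η 0 then x else y, fun _ _ => y, fun η i ρ _ => ?_⟩
  obtain rfl : i = 0 := Subsingleton.elim _ _
  cases hη : η 0 <;> simp [hη, h]

lemma excellent_of_forall_not_adj {G : SimpleGraph V} (hG : ∀ x y, ¬ G.Adj x y) {ε ζ : ℝ}
    (hε : 0 < ε) (hζ : 0 < ζ) {A : Finset V} (hA : A.Nonempty) : Excellent G ε ζ A := by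
  obtain ⟨v, -⟩ := id hA
  have : Nonempty V := ⟨v⟩
  have havg : ∀ {δ : ℝ}, 0 < δ → ∀ {B : Finset V}, B.Nonempty → ∀ a, AvgIs G δ B a false := by
    intro δ hδ B hB a
    have : (0 : ℝ) < B.card := by exact_mod_cast hB.card_pos
    simpa [AvgIs, hG] using mul_pos hδ this
  refine ⟨fun b => ⟨false, havg hε hA b⟩, fun B hB => ⟨false, ?_⟩⟩
  have : (0 : ℝ) < A.card := by exact_mod_cast hA.card_pos
  simpa [havg hζ hB.nonempty] using mul_pos hε this

lemma isEmpty_of_noTreeProp_zero {G : SimpleGraph V} (hG : NoTreeProp G 0) : IsEmpty V :=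
  ⟨fun v => hG ⟨fun _ => v, fun i => i.elim0, fun _ i => i.elim0⟩⟩

lemma Good.mono {G : SimpleGraph V} {ε δ : ℝ} (h : ε ≤ δ) {A : Finset V} (hA : Good G ε A) :
    Good G δ A := fun b => by
  obtain ⟨t, ht⟩ := hA b
  exact ⟨t, lt_of_lt_of_le ht (by gcongr)⟩

/-- If large subsets of `A` contain `ε`-good sets of a fixed size `c`, then `A` has an equitable
partition into `3ε`-excellent sets. -/
lemma exists_equitable_excellent_partition {G : SimpleGraph V} {ε : ℝ} (hε : 3 * ε ≤ 1 / 4)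
    {c M : ℕ} (hε0 : 0 < ε) (hc : 1 ≤ ε * c) (hcM : c ≤ M) {A : Finset V}
    (hM : (M : ℝ) * (1 + ε) ≤ ε * A.card + 1)
    (h : ∀ X ⊆ A, M ≤ X.card → ∃ Q ⊆ X, Q.card = c ∧ Good G ε Q) :
    ∃ s : ℕ, s * c ≤ A.card ∧ ∃ P : Fin s → Finset V,
      (∀ i, P i ⊆ A) ∧ (∀ i j, i ≠ j → Disjoint (P i) (P j)) ∧ (∀ a ∈ A, ∃ i, a ∈ P i) ∧
      (∀ i j, |((P i).card : ℤ) - ((P j).card : ℤ)| ≤ 1) ∧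
      ∀ i, Excellent G (3 * ε) (3 * ε) (P i) := by
  have hc0 : 0 < c := by
    rcases Nat.eq_zero_or_pos c with rfl | h0
    · norm_num at hc
    · exact h0
  have hMA : M ≤ A.card := by
    by_contra! hlt
    have h1 : (A.card : ℝ) + 1 ≤ M := by exact_mod_cast hlt
    have h2 : (1 : ℝ) ≤ M := by exact_mod_cast hc0.trans_le hcM
    nlinarith
  obtain ⟨s, hs⟩ : ∃ s, s = (A.card - M) / c + 1 := ⟨_, rfl⟩
  have hdiv := Nat.div_add_mod (A.card - M) c
  have hmod := Nat.mod_lt (A.card - M) hc0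
  have hsc : s * c = c * ((A.card - M) / c) + c := by rw [hs]; ring
  obtain ⟨Q, hQA, hQd, hQc, hQg⟩ := exists_disjoint_family h s (by
    rw [hs, Nat.add_sub_cancel, mul_comm]; omega)
  set U := Finset.univ.biUnion Q with hU
  have hUc : U.card = s * c := by
    rw [hU, Finset.card_biUnion fun i _ j _ hij => hQd i j hij]
    simp [hQc]
  have hUA : U ⊆ A := Finset.biUnion_subset.2 fun i _ => hQA i
  have hR : (A \ U).card = A.card - s * c := by rw [Finset.card_sdiff_of_subset hUA, hUc]
  obtain ⟨T, hTR, hTd, hTcov, hTc⟩ := exists_equitable_family (A \ U) (s := s)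
    (hs ▸ Nat.succ_pos _)
  have hQT : ∀ i j, Disjoint (Q i) (T j) := fun i j =>
    Finset.disjoint_of_subset_left (Finset.subset_biUnion_of_mem Q (Finset.mem_univ i))
      (Finset.disjoint_of_subset_right (hTR j) Finset.disjoint_sdiff)
  have hPc : ∀ i, (Q i ∪ T i).card = c + (T i).card := fun i => by
    rw [Finset.card_union_of_disjoint (hQT i i), hQc]
  have hceil : 1 ≤ ⌈ε * c⌉₊ := Nat.one_le_iff_ne_zero.2 (by
    rw [Ne, Nat.ceil_eq_zero]; linarith)
  obtain ⟨e, he⟩ : ∃ e, ⌈ε * c⌉₊ = e + 1 := ⟨_, (Nat.sub_add_cancel hceil).symm⟩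
  have helt : (e : ℝ) < ε * c := Nat.lt_ceil.1 (by omega)
  have hele : ε * c ≤ e + 1 := by
    have := Nat.le_ceil (ε * c)
    rw [he] at this
    exact_mod_cast this
  have hTe : (A \ U).card / s ≤ e := by
    have hlt : (A \ U).card < s * (e + 1) := by
      have h1 : (((A \ U).card + 1 : ℕ) : ℝ) ≤ M := by
        norm_cast
        omega
      have h2 : (A.card : ℝ) < ((M + s * c : ℕ) : ℝ) := by
        norm_cast
        omega
      push_cast at h1 h2
      have h3 : ε * (A.card : ℝ) < ε * (M + s * c) := by gcongr
      have h4 : (s : ℝ) * (ε * c) ≤ s * (e + 1) := by gcongr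
      have h5 : ((A \ U).card : ℝ) < ((s * (e + 1) : ℕ) : ℝ) := by
        push_cast
        nlinarith
      exact_mod_cast h5
    exact Nat.lt_succ_iff.1 (Nat.div_lt_of_lt_mul hlt)
  refine ⟨s, by omega, fun i => Q i ∪ T i, fun i => ?_, fun i j hij => ?_, fun a ha => ?_,
    fun i j => ?_, fun i => ?_⟩
  · exact Finset.union_subset (hQA i) ((hTR i).trans Finset.sdiff_subset)
  · simp only [Finset.disjoint_union_left, Finset.disjoint_union_right]
    exact ⟨⟨hQd i j hij, (hQT j i).symm⟩, hQT i j, hTd i j hij⟩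
  · by_cases haU : a ∈ U
    · obtain ⟨i, -, hi⟩ := Finset.mem_biUnion.1 haU
      exact ⟨i, Finset.mem_union_left _ hi⟩
    · obtain ⟨i, hi⟩ := hTcov a (Finset.mem_sdiff.2 ⟨ha, haU⟩)
      exact ⟨i, Finset.mem_union_right _ hi⟩
  · rw [hPc, hPc, abs_le]
    have := hTc i
    have := hTc j
    omega
  · have hcP : (c : ℝ) ≤ (Q i ∪ T i).card := by
      rw [hPc]
      push_cast
      linarith [Nat.cast_nonneg (α := ℝ) (T i).card]
    have hcP' : ε * c ≤ ε * (Q i ∪ T i).card := by gcongr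
    refine excellent_of_good_core hε (e := e) Finset.subset_union_left (fun b => ?_) ?_
      (by linarith) (by linarith)
    · obtain ⟨t, ht⟩ := hQg i b
      refine ⟨t, Nat.lt_succ_iff.1 ?_⟩
      rw [AvgIs, hQc] at ht
      have := ht.trans_le hele
      exact_mod_cast this
    · rw [Finset.union_sdiff_cancel_left (hQT i i)]
      have := hTc i
      omega

end Paper

theorem stmt10 (ks kss : ℕ) (V : Type) [Fintype V] (G : SimpleGraph V)
    (hG1 : NoOrderProp G ks) (hG2 : NoTreeProp G kss)
    (ε1 ε3 : ℝ)
    (h1 : 0 < ε3) (h2 : ε3 < ε1 / 3) (h3 : ε1 < 1 / 2 ^ kss)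
    (m : ℕ → ℕ)
    (hpos : ∀ ℓ, ℓ < kss → 0 < m ℓ)
    (hdec : ∀ ℓ, ℓ + 1 < kss → (m (ℓ + 1) : ℝ) < ε3 * m ℓ)
    (hdvd : ∀ ℓ, ℓ < kss → m (kss - 1) ∣ m ℓ)
    (hloglog : Real.log (Real.log (m 0)) ≤ (m (kss - 1) : ℝ))
    (hbig : max (kss : ℝ) (1 / (ε1 / 3)) ≤ (m (kss - 1) : ℝ))
    (N : ℕ)
    (hN : ∀ r : ℕ, (r : ℝ) ≤ (m 0 : ℝ) / m (kss - 1) →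
      ∀ B : Finset V, Excellent G ε3 ε3 B → N < B.card → r ∣ B.card →
        ∃ Q : Fin r → Finset V,
          (∀ i, Q i ⊆ B) ∧
          (∀ i j, i ≠ j → Disjoint (Q i) (Q j)) ∧
          (∀ b ∈ B, ∃ i, b ∈ Q i) ∧
          (∀ i j, (Q i).card = (Q j).card) ∧
          (∀ i, Excellent G (ε1 / 3) (ε1 / 3) (Q i)))
    (hN2 : N < m (kss - 2))
    (A : Finset V) (n : ℕ) (hA : A.card = n)
    (hm0 : (m 0 : ℝ) ≤ (ε1 / 3 * n + 1) / (1 + ε1 / 3)) :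
    ∃ istar : ℕ, (istar : ℝ) ≤ (n : ℝ) / m (kss - 1) ∧
      ∃ P : Fin istar → Finset V,
        (∀ i, P i ⊆ A) ∧
        (∀ i j, i ≠ j → Disjoint (P i) (P j)) ∧
        (∀ a ∈ A, ∃ i, a ∈ P i) ∧
        (∀ i j, |((P i).card : ℤ) - ((P j).card : ℤ)| ≤ 1) ∧
        (∀ i, Excellent G ε1 ε1 (P i)) ∧
        (∀ i j, i ≠ j → Uniform G ε1 ε1 (P i) (P j)) := by
  have hε1 : 0 < ε1 := by linarith
  obtain rfl | rfl | hk : kss = 0 ∨ kss = 1 ∨ 2 ≤ kss := by omega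
  · have := isEmpty_of_noTreeProp_zero hG2
    exact ⟨0, by simp; positivity, fun i => i.elim0, fun i => i.elim0, fun i => i.elim0,
      fun a => isEmptyElim a, fun i => i.elim0, fun i => i.elim0, fun i => i.elim0⟩
  · have hmpos : (1 : ℝ) ≤ m 0 := by exact_mod_cast hpos 0 one_pos
    have hmn : (m 0 : ℝ) ≤ n := by
      rw [le_div_iff₀ (by linarith)] at hm0
      nlinarith
    have hne : A.Nonempty := by
      rw [← Finset.card_pos, hA]
      exact_mod_cast (by linarith : (0 : ℝ) < n)
    refine ⟨1, ?_, fun _ => A, fun _ => subset_rfl, fun i j hij => ?_, fun a ha => ⟨0, ha⟩,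
      by simp, fun _ => ?_, fun i j hij => ?_⟩
    · rw [le_div_iff₀ (by simpa using hpos 0 one_pos)]
      simpa using hmn
    · exact absurd (Subsingleton.elim i j) hij
    · exact excellent_of_forall_not_adj (not_adj_of_noTreeProp_one hG2) hε1 hε1 hne
    · exact absurd (Subsingleton.elim i j) hij
  have hpow : (1 : ℝ) / 2 ^ kss ≤ 1 / 4 := by
    have h : (2 : ℝ) ^ 2 ≤ 2 ^ kss := pow_le_pow_right₀ (by norm_num) hk
    exact one_div_le_one_div_of_le (by norm_num) (by linarith)
  have hanti : ∀ i j, i ≤ j → j < kss → m j ≤ m i := by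
    intro i j hij
    induction j, hij using Nat.le_induction with
    | base => exact fun _ => le_rfl
    | succ j _ ih =>
      intro hj
      refine le_trans ?_ (ih (by omega))
      have h := hdec j hj
      have h' : ε3 * m j ≤ 1 * m j := by gcongr; linarith
      exact_mod_cast (by linarith : (m (j + 1) : ℝ) ≤ m j)
  set c := m (kss - 1) with hc
  have hcpos : 0 < c := hpos _ (by omega)
  have hcpos' : (0 : ℝ) < c := by exact_mod_cast hcpos
  have hc1 : 1 ≤ ε1 / 3 * c := by
    have := (le_max_right _ _).trans hbig
    rwa [div_le_iff₀ (by positivity), mul_comm] at this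
  have hpiece : ∀ X ⊆ A, m 0 ≤ X.card → ∃ Q ⊆ X, Q.card = c ∧ Good G (ε1 / 3) Q := by
    intro X _ hX
    obtain ⟨ℓ, hℓ, B, hBX, hBc, hB⟩ :=
      exists_excellent_subset hG2 h1 (by linarith) (by omega) hpos hdec hX
    obtain hl | rfl : ℓ ≤ kss - 2 ∨ ℓ = kss - 1 := by omega
    · obtain ⟨r, hr⟩ := hdvd ℓ hℓ
      have hr0 : 0 < r := by
        rcases Nat.eq_zero_or_pos r with rfl | h0
        · have := hpos ℓ hℓ
          omega
        · exact h0
      have hrm : (r : ℝ) ≤ (m 0 : ℝ) / c := by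
        rw [le_div_iff₀ hcpos']
        have := hanti 0 ℓ (by omega) hℓ
        rw [hr, mul_comm] at this
        exact_mod_cast this
      obtain ⟨Q, hQB, hQd, hQcov, hQc, hQe⟩ := hN r hrm B hB
        (by rw [hBc]; exact hN2.trans_le (hanti _ _ hl (by omega))) ⟨c, by rw [hBc, hr, mul_comm]⟩
      refine ⟨Q ⟨0, hr0⟩, (hQB _).trans hBX, ?_, (hQe _).1⟩
      have hun : Finset.univ.biUnion Q = B := by
        ext b
        simp only [Finset.mem_biUnion, Finset.mem_univ, true_and]
        exact ⟨fun ⟨i, hi⟩ => hQB i hi, hQcov b⟩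
      have hsum := Finset.card_biUnion (s := Finset.univ) (t := Q) fun i _ j _ hij => hQd i j hij
      rw [hun, hBc, hr, Finset.sum_congr rfl fun i _ => hQc i ⟨0, hr0⟩] at hsum
      simp only [Finset.sum_const, Finset.card_univ, Fintype.card_fin, smul_eq_mul] at hsum
      rw [mul_comm] at hsum
      exact (Nat.eq_of_mul_eq_mul_left hr0 hsum).symm
    · exact ⟨B, hBX, hBc, hB.1.mono h2.le⟩
  have hm0' : (m 0 : ℝ) * (1 + ε1 / 3) ≤ ε1 / 3 * A.card + 1 := by
    rw [hA]
    rwa [le_div_iff₀ (by positivity)] at hm0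
  obtain ⟨s, hs, P, hPA, hPd, hPcov, hPc, hPe⟩ :=
    exists_equitable_excellent_partition (by linarith) (by positivity) hc1
      (hanti 0 _ (by omega) (by omega)) hm0' hpiece
  rw [mul_div_cancel₀ ε1 (by norm_num : (3 : ℝ) ≠ 0)] at hPe
  refine ⟨s, ?_, P, hPA, hPd, hPcov, hPc, hPe, fun i j _ => (hPe i).uniform (hPe j)⟩
  rw [le_div_iff₀ hcpos']
  rw [hA] at hs
  exact_mod_cast hs
end

section
/- Let G be a finite graph, A and B disjoint nonempty subsets of G, and ε, ζ, ξ ∈ (0,1/2) with (ε+ζ)/ξ < 1/2. Suppose t ∈ {0,1} is a truth value witnessing that (A,B) is (ε,ζ)-uniform, and set Z = {(a,b) ∈ A×B : (a R b) ≢ t}. Then: (1) |Z| < (ε+ζ)·|A|·|B|; and (2) for all A′ ⊆ A and B′ ⊆ B with |A′| ≥ ξ|A| and |B′| ≥ ξ|B|, setting Z′ = {(a,b) ∈ A′×B′ : (a R b) ≢ t}, one has |Z′| < ((ε+ζ)/ξ)·|A′|·|B′|. In particular, for any ε ∈ (0,1/2), if (A,B) is (ε_0,ε_0)-uniform for some ε_0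 ≤ ε²/2, then (A,B) is ε-regular. -/
open Finset

open scoped Classical

open Paper

namespace Paper

/-- If all but fewer than `ε|A|` elements of `A` have `ζ`-average `t` over `B`, then the number of
pairs in `A' × B'` which disagree with `t` is less than `ε|A||B'| + ζ|A'||B|`. -/
theorem card_disagree_lt {V : Type} (G : SimpleGraph V) {A B A' B' : Finset V} {ε ζ : ℝ} {t : Bool}
    (hζ : 0 ≤ ζ) (ht : ((A.filter fun a => ¬ AvgIs G ζ B a t).card : ℝ) < ε * A.card)
    (hA' : A' ⊆ A) (hB' : B' ⊆ B) (hne : B'.Nonempty) :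
    (((A' ×ˢ B').filter fun p => ¬ (G.Adj p.1 p.2 ↔ t = true)).card : ℝ)
      < ε * A.card * B'.card + ζ * A'.card * B.card := by
  have hpos : (0 : ℝ) < B'.card := by exact_mod_cast hne.card_pos
  have hsum : (((A' ×ˢ B').filter fun p => ¬ (G.Adj p.1 p.2 ↔ t = true)).card : ℝ)
      = ∑ a ∈ A', ((B'.filter fun b => ¬ (G.Adj a b ↔ t = true)).card : ℝ) := by
    simp only [Finset.card_filter, Finset.sum_product, Nat.cast_sum]
  have hpt : ∀ a ∈ A', ((B'.filter fun b => ¬ (G.Adj a b ↔ t = true)).card : ℝ)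
      ≤ (if ¬ AvgIs G ζ B a t then (1 : ℝ) else 0) * B'.card + ζ * B.card := by
    intro a _
    by_cases h : AvgIs G ζ B a t
    · have hle : ((B'.filter fun b => ¬ (G.Adj a b ↔ t = true)).card : ℝ)
          ≤ (B.filter fun b => ¬ (G.Adj a b ↔ t = true)).card := by
        exact_mod_cast Finset.card_le_card (Finset.filter_subset_filter _ hB')
      rw [if_neg (not_not.mpr h), zero_mul, zero_add]
      exact hle.trans (le_of_lt h)
    · have hle : ((B'.filter fun b => ¬ (G.Adj a b ↔ t = true)).card : ℝ) ≤ B'.card := by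
        exact_mod_cast Finset.card_filter_le _ _
      rw [if_pos h, one_mul]
      have : 0 ≤ ζ * (B.card : ℝ) := by positivity
      linarith
  have hbad : ((A'.filter fun a => ¬ AvgIs G ζ B a t).card : ℝ) < ε * A.card := by
    refine lt_of_le_of_lt ?_ ht
    exact_mod_cast Finset.card_le_card (Finset.filter_subset_filter _ hA')
  calc _ ≤ ∑ a ∈ A', ((if ¬ AvgIs G ζ B a t then (1 : ℝ) else 0) * B'.card + ζ * B.card) :=
        hsum.trans_le (Finset.sum_le_sum hpt)
    _ = ((A'.filter fun a => ¬ AvgIs G ζ B a t).card : ℝ) * B'.card + ζ * A'.card * B.card := by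
        rw [Finset.sum_add_distrib, ← Finset.sum_mul, Finset.sum_boole, Finset.sum_const,
          nsmul_eq_mul]
        ring
    _ < _ := by gcongr

/-- In a pair of subsets of relative size at least `ξ`, the proportion of pairs which disagree
with the truth value witnessing `(ε,ζ)`-uniformity is less than `(ε + ζ) / ξ`. -/
theorem card_disagree_lt_div {V : Type} (G : SimpleGraph V) {A B A' B' : Finset V} {ε ζ ξ : ℝ}
    {t : Bool} (hε : 0 ≤ ε) (hζ : 0 ≤ ζ) (hξ : 0 < ξ)
    (ht : ((A.filter fun a => ¬ AvgIs G ζ B a t).card : ℝ) < ε * A.card)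
    (hA' : A' ⊆ A) (hB' : B' ⊆ B) (hne : B'.Nonempty)
    (hcA : ξ * A.card ≤ (A'.card : ℝ)) (hcB : ξ * B.card ≤ (B'.card : ℝ)) :
    (((A' ×ˢ B').filter fun p => ¬ (G.Adj p.1 p.2 ↔ t = true)).card : ℝ)
      < (ε + ζ) / ξ * A'.card * B'.card := by
  refine (card_disagree_lt G hζ ht hA' hB' hne).trans_le ?_
  have h₁ : (A.card : ℝ) ≤ A'.card / ξ := by rw [le_div_iff₀ hξ]; linarith
  have h₂ : (B.card : ℝ) ≤ B'.card / ξ := by rw [le_div_iff₀ hξ]; linarith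
  calc ε * A.card * B'.card + ζ * A'.card * B.card
      ≤ ε * (A'.card / ξ) * B'.card + ζ * A'.card * (B'.card / ξ) := by gcongr
    _ = _ := by ring

/-- The density is the proportion of pairs disagreeing with `t`, or one minus that proportion. -/
theorem density_eq_disagree {V : Type} (G : SimpleGraph V) {A B : Finset V} (hA : A.Nonempty)
    (hB : B.Nonempty) (t : Bool) :
    density G A B =
      if t then 1 - (((A ×ˢ B).filter fun p => ¬ (G.Adj p.1 p.2 ↔ t = true)).card : ℝ)
        / (A.card * B.card)
      else (((A ×ˢ B).filter fun p => ¬ (G.Adj p.1 p.2 ↔ t = true)).card : ℝ)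
        / (A.card * B.card) := by
  have h₁ : (A.card : ℝ) ≠ 0 := by exact_mod_cast hA.card_pos.ne'
  have h₂ : (B.card : ℝ) ≠ 0 := by exact_mod_cast hB.card_pos.ne'
  cases t
  · simp [density]
  · have h : (((A ×ˢ B).filter fun p => G.Adj p.1 p.2).card : ℝ)
        + ((A ×ˢ B).filter fun p => ¬ G.Adj p.1 p.2).card = A.card * B.card := by
      rw [← Nat.cast_mul, ← Finset.card_product]
      exact_mod_cast Finset.card_filter_add_card_filter_not (s := A ×ˢ B) fun p => G.Adj p.1 p.2
    simp only [density, iff_true, if_true]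
    rw [← h, eq_sub_iff_add_eq, ← add_div, h]
    exact div_self (mul_ne_zero h₁ h₂)

/-- An `(ε₀,ε₀)`-uniform pair with `ε₀ ≤ ε² / 2` and `ε ≤ 1` is `ε`-regular. -/
theorem Uniform.regular {V : Type} {G : SimpleGraph V} {A B : Finset V} {ε ε₀ : ℝ}
    (hA : A.Nonempty) (hB : B.Nonempty) (hε : 0 < ε) (hε1 : ε ≤ 1) (hε₀ : ε₀ ≤ ε ^ 2 / 2)
    (h : Uniform G ε₀ ε₀ A B) : Regular G ε A B := by
  obtain ⟨t, ht⟩ := h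
  intro A' hA' B' hB' hcA hcB
  have pA : (0 : ℝ) < A.card := by exact_mod_cast hA.card_pos
  have pB : (0 : ℝ) < B.card := by exact_mod_cast hB.card_pos
  have pA' : (0 : ℝ) < A'.card := (mul_pos hε pA).trans_le hcA
  have pB' : (0 : ℝ) < B'.card := (mul_pos hε pB).trans_le hcB
  have neA' : A'.Nonempty := Finset.card_pos.mp (by exact_mod_cast pA')
  have neB' : B'.Nonempty := Finset.card_pos.mp (by exact_mod_cast pB')
  have pε₀ : 0 ≤ ε₀ := (pos_of_mul_pos_left ((Nat.cast_nonneg _).trans_lt ht) pA.le).le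
  have key : ∀ C ⊆ A, ∀ D ⊆ B, C.Nonempty → D.Nonempty → ε * A.card ≤ (C.card : ℝ) →
      ε * B.card ≤ (D.card : ℝ) →
      (((C ×ˢ D).filter fun p => ¬ (G.Adj p.1 p.2 ↔ t = true)).card : ℝ)
        / (C.card * D.card) < ε := by
    intro C hC D hD neC neD hcC hcD
    have pC : (0 : ℝ) < C.card := by exact_mod_cast neC.card_pos
    have pD : (0 : ℝ) < D.card := by exact_mod_cast neD.card_pos
    rw [div_lt_iff₀ (mul_pos pC pD)]
    refine (card_disagree_lt_div G pε₀ pε₀ hε ht hC hD neD hcC hcD).trans_le ?_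
    rw [mul_assoc]
    gcongr
    rw [div_le_iff₀ hε]
    nlinarith
  have k₁ := key A subset_rfl B subset_rfl hA hB (by nlinarith) (by nlinarith)
  have k₂ := key A' hA' B' hB' neA' neB' hcA hcB
  rw [density_eq_disagree G hA hB t, density_eq_disagree G neA' neB' t]
  have n₁ : 0 ≤ (((A ×ˢ B).filter fun p => ¬ (G.Adj p.1 p.2 ↔ t = true)).card : ℝ)
      / (A.card * B.card) := by positivity
  have n₂ : 0 ≤ (((A' ×ˢ B').filter fun p => ¬ (G.Adj p.1 p.2 ↔ t = true)).card : ℝ)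
      / (A'.card * B'.card) := by positivity
  split_ifs <;> rw [abs_lt] <;> constructor <;> linarith

end Paper

theorem stmt11 (V : Type) [Fintype V] (G : SimpleGraph V)
    (A B : Finset V) (hdisj : Disjoint A B) (hA : A.Nonempty) (hB : B.Nonempty)
    (ε ζ ξ : ℝ) (hε : 0 < ε ∧ ε < 1 / 2) (hζ : 0 < ζ ∧ ζ < 1 / 2)
    (hξ : 0 < ξ ∧ ξ < 1 / 2)
    (hratio : (ε + ζ) / ξ < 1 / 2)
    (t : Bool)
    (ht : ((A.filter fun a => ¬ AvgIs G ζ B a t).card : ℝ) < ε * A.card) :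
    ((((A ×ˢ B).filter fun p => ¬ (G.Adj p.1 p.2 ↔ t = true)).card : ℝ)
        < (ε + ζ) * A.card * B.card) ∧
    (∀ A' ⊆ A, ∀ B' ⊆ B, ξ * A.card ≤ (A'.card : ℝ) → ξ * B.card ≤ (B'.card : ℝ) →
      (((A' ×ˢ B').filter fun p => ¬ (G.Adj p.1 p.2 ↔ t = true)).card : ℝ)
        < (ε + ζ) / ξ * A'.card * B'.card) ∧
    (∀ ε' : ℝ, 0 < ε' → ε' < 1 / 2 → ∀ ε0 : ℝ, ε0 ≤ ε' ^ 2 / 2 →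
      Uniform G ε0 ε0 A B → Regular G ε' A B) := by
  refine ⟨?_, fun A' hA' B' hB' hcA hcB => ?_, fun ε' h₀ h₁ ε0 hε0 hu => ?_⟩
  · simpa using card_disagree_lt_div G hε.1.le hζ.1.le one_pos ht subset_rfl subset_rfl hB
      (by simp) (by simp)
  · have pB : (0 : ℝ) < B.card := by exact_mod_cast hB.card_pos
    have pB' : (0 : ℝ) < B'.card := (mul_pos hξ.1 pB).trans_le hcB
    exact card_disagree_lt_div G hε.1.le hζ.1.le hξ.1 ht hA' hB'
      (Finset.card_pos.mp (by exact_mod_cast pB')) hcA hcB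
  · exact hu.regular hA hB h₀ (by linarith) hε0
end

section
/- Let k** ∈ ℕ, let G be a finite graph with the non-k**-tree property, let f : ℕ → ℕ∖{0} be nondecreasing, and let m_0 > m_1 > … > m_{k**} be nonzero natural numbers with f(m_ℓ) ≥ m_{ℓ+1} for every ℓ < k**. If A ⊆ G with |A| = m_0, then for some ℓ < k** there exists an f-indivisible B ⊆ A with |B| = m_ℓ. -/
open Finset

open scoped Classical

open Paper

/-- A full binary tree of height `d` in `G` whose leaves lie in `B`. -/
def TreeIn {V : Type} (G : SimpleGraph V) (d : ℕ) (B : Finset V) : Prop :=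
  ∃ (a : (Fin d → Bool) → V) (b : (m : Fin d) → (Fin (m : ℕ) → Bool) → V),
    (∀ η, a η ∈ B) ∧
      ∀ (η : Fin d → Bool) (m : Fin d) (ρ : Fin (m : ℕ) → Bool),
        (∀ i : Fin (m : ℕ), η ⟨i.1, i.2.trans m.2⟩ = ρ i) →
        (G.Adj (a η) (b m ρ) ↔ η m = true)

theorem TreeIn.zero {V : Type} (G : SimpleGraph V) {B : Finset V} (hB : B.Nonempty) :
    TreeIn G 0 B := by
  obtain ⟨x, hx⟩ := hB
  exact ⟨fun _ => x, fun m => m.elim0, fun _ => hx, fun _ m => m.elim0⟩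

/-- Two trees whose leaves are separated by the vertex `v` glue to a tree with root `v`. -/
theorem TreeIn.succ {V : Type} {G : SimpleGraph V} {d : ℕ} {B : Finset V} (v : V)
    (C : Bool → Finset V) (hCB : ∀ t, C t ⊆ B)
    (hC : ∀ t, ∀ x ∈ C t, (G.Adj x v ↔ t = true)) (hT : ∀ t, TreeIn G d (C t)) :
    TreeIn G (d + 1) B := by
  choose a b ha hab using hT
  refine ⟨fun η => a (η 0) (Fin.tail η),
    fun m => Fin.cases (motive := fun m : Fin (d + 1) => (Fin (m : ℕ) → Bool) → V)
      (fun _ => v)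
      (fun m ρ => b (ρ ⟨0, Nat.succ_pos _⟩) m (fun i => ρ ⟨i + 1, Nat.succ_lt_succ i.2⟩)) m,
    fun η => hCB _ (ha _ _), ?_⟩
  intro η m ρ h
  induction m using Fin.cases with
  | zero => exact hC _ _ (ha _ _)
  | succ m =>
    have h0 : η 0 = ρ ⟨0, Nat.succ_pos _⟩ := h ⟨0, Nat.succ_pos _⟩
    simp only [Fin.cases_succ, ← h0]
    exact hab (η 0) (Fin.tail η) m _ fun i => h ⟨i + 1, Nat.succ_lt_succ i.2⟩

theorem exists_split_of_not_indivisible {V : Type} {G : SimpleGraph V} {f : ℕ → ℕ}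
    {B : Finset V} (h : ¬ Indivisible G f B) {n : ℕ} (hn : n ≤ f B.card) :
    ∃ (v : V) (C : Bool → Finset V), (∀ t, C t ⊆ B) ∧ (∀ t, (C t).card = n) ∧
      ∀ t, ∀ x ∈ C t, (G.Adj x v ↔ t = true) := by
  unfold Indivisible at h
  push Not at h
  obtain ⟨v, hv⟩ := h
  choose C hCB hC using fun t => Finset.exists_subset_card_eq (hn.trans (hv (!t)))
  refine ⟨v, C, fun t => (hCB t).trans (Finset.filter_subset _ _), hC, fun t x hx => ?_⟩
  have := (Finset.mem_filter.1 (hCB t hx)).2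
  cases t <;> simp_all

theorem stmt12 (kss : ℕ) (V : Type) [Fintype V] (G : SimpleGraph V)
    (hG : NoTreeProp G kss) (f : ℕ → ℕ) (hf1 : ∀ n, 0 < f n) (hf2 : Monotone f)
    (m : ℕ → ℕ) (hm0 : ∀ ℓ, ℓ ≤ kss → 0 < m ℓ)
    (hdec : ∀ ℓ, ℓ < kss → m (ℓ + 1) < m ℓ)
    (hfm : ∀ ℓ, ℓ < kss → m (ℓ + 1) ≤ f (m ℓ))
    (A : Finset V) (hA : A.card = m 0) :
    ∃ ℓ < kss, ∃ B ⊆ A, B.card = m ℓ ∧ Indivisible G f B := by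
  by_contra! hcon
  have key : ∀ d ℓ, ℓ + d = kss → ∀ B ⊆ A, B.card = m ℓ → TreeIn G d B := by
    intro d
    induction d with
    | zero =>
      intro ℓ hℓ B _ hB
      exact TreeIn.zero G (Finset.card_pos.1 (hB ▸ hm0 ℓ (by omega)))
    | succ d ih =>
      intro ℓ hℓ B hBA hB
      have hlt : ℓ < kss := by omega
      obtain ⟨v, C, hCB, hcard, hC⟩ :=
        exists_split_of_not_indivisible (hcon ℓ hlt B hBA hB) (hB ▸ hfm ℓ hlt)
      exact TreeIn.succ v C hCB hC fun t =>
        ih (ℓ + 1) (by omega) (C t) ((hCB t).trans hBA) (hcard t)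
  obtain ⟨a, b, -, hab⟩ := key kss 0 (Nat.zero_add _) A subset_rfl hA
  exact hG ⟨a, b, hab⟩
end

section
/- Let k** ∈ ℕ, let G be a finite graph with the non-k**-tree property, let ε ∈ (0,1/2), and let n ∈ ℕ with n^{ε^{k**}} > k**. Let ⟨m_ℓ : 0 ≤ ℓ ≤ k**⟩ be integers with n ≥ m_0, m_{k**} > k**, and m_{ℓ+1} = ⌊(m_ℓ)^ε⌋ for every ℓ < k**. Then for every A ⊆ G with |A| = n there is a sequence ⟨A_i : i < i(*)⟩ of pairwise disjoint subsets of A such that: (1) the sequence ⟨|A_i| : i < i(*)⟩ is nondecreasing; (2) for each i < i(*) there is ℓ(i) < k** with |A_i| = m_{ℓ(i)}, and A_i is ε-indivisible; and (3) |A ∖ ⋃_{i<i(*)} A_i| < m_0. -/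
open Finset

open scoped Classical

open Paper

/-- A set containing no indivisible subset of size `m ℓ` for `ℓ < k` carries a full binary tree
of height `k`, whose leaves lie in the set. -/
theorem exists_tree_of_forall_not_epsIndivisible {V : Type} (G : SimpleGraph V) (ε : ℝ) (k : ℕ) :
    ∀ (m : ℕ → ℕ) (B : Finset V), 0 < m k →
      (∀ ℓ, ℓ < k → m (ℓ + 1) = ⌊(m ℓ : ℝ) ^ ε⌋₊) → B.card = m 0 →
      (∀ ℓ < k, ∀ P ⊆ B, P.card = m ℓ → ¬ EpsIndivisible G ε P) →
      ∃ (a : (Fin k → Bool) → V) (b : (m : Fin k) → (Fin (m : ℕ) → Bool) → V),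
        (∀ η, a η ∈ B) ∧
        ∀ (η : Fin k → Bool) (m : Fin k) (ρ : Fin (m : ℕ) → Bool),
          (∀ i : Fin (m : ℕ), η ⟨i.1, i.2.trans m.2⟩ = ρ i) →
          (G.Adj (a η) (b m ρ) ↔ η m = true) := by
  induction k with
  | zero =>
    intro m B hm _ hB _
    obtain ⟨v, hv⟩ : B.Nonempty := by rw [← card_pos, hB]; exact hm
    exact ⟨fun _ => v, fun i => i.elim0, fun _ => hv, fun _ i => i.elim0⟩
  | succ k ih =>
    intro m B hm hrec hB hdiv
    have hroot := hdiv 0 k.succ_pos B subset_rfl hB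
    simp only [EpsIndivisible, not_forall, not_exists, not_lt] at hroot
    obtain ⟨r, hr⟩ := hroot
    have hside : ∀ t : Bool, ∃ C ⊆ B, C.card = m 1 ∧ ∀ x ∈ C, (G.Adj x r ↔ t = true) := by
      intro t
      have hle : m 1 ≤ (B.filter fun x => ¬ (G.Adj x r ↔ (!t) = true)).card := by
        rw [hrec 0 k.succ_pos, ← hB]
        exact Nat.floor_le_of_le (hr (!t))
      obtain ⟨C, hCs, hC⟩ := exists_subset_card_eq hle
      refine ⟨C, hCs.trans (filter_subset _ _), hC, fun x hx => ?_⟩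
      have hx' := (mem_filter.1 (hCs hx)).2
      cases t <;> simpa using hx'
    choose C hCB hC hCr using hside
    have htree := fun t => ih (fun ℓ => m (ℓ + 1)) (C t) hm
      (fun ℓ hℓ => hrec (ℓ + 1) (by omega)) (hC t)
      (fun ℓ hℓ P hP hPc => hdiv (ℓ + 1) (by omega) P (hP.trans (hCB t)) hPc)
    choose a b haC hab using htree
    refine ⟨fun η => a (η 0) (fun i => η i.succ),
      fun j => Fin.cases (motive := fun j : Fin (k + 1) => (Fin (j : ℕ) → Bool) → V)
        (fun _ => r) (fun i ρ => b (ρ ⟨0, Nat.succ_pos _⟩) i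
          (fun l => ρ ⟨l + 1, Nat.succ_lt_succ l.2⟩)) j,
      fun η => hCB _ (haC _ _), fun η j => ?_⟩
    refine Fin.cases (fun ρ _ => hCr _ _ (haC _ _)) (fun i ρ hρ => ?_) j
    have h0 : η 0 = ρ ⟨0, Nat.succ_pos _⟩ := hρ ⟨0, Nat.succ_pos _⟩
    simp only [Fin.cases_succ, ← h0]
    exact hab (η 0) (fun l => η l.succ) i _
      (fun l => hρ ⟨l + 1, Nat.succ_lt_succ l.2⟩)

/-- If every subset of `A` of size at least `N` contains a nonempty set satisfying `p`, then all
but fewer than `N` elements of `A` can be covered by disjoint sets satisfying `p`. -/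
theorem exists_disjoint_family_card_lt {V : Type} (p : Finset V → Prop) (N : ℕ) (A : Finset V)
    (h : ∀ B ⊆ A, N ≤ B.card → ∃ P ⊆ B, P.Nonempty ∧ p P) :
    ∃ (r : ℕ) (P : Fin r → Finset V), (∀ i, P i ⊆ A) ∧
      (∀ i j, i ≠ j → Disjoint (P i) (P j)) ∧ (∀ i, p (P i)) ∧
      (A.filter fun a => ∀ i, a ∉ P i).card < N := by
  induction A using Finset.strongInduction with
  | H A ih =>
    rcases lt_or_ge A.card N with hlt | hge
    · exact ⟨0, fun i => i.elim0, fun i => i.elim0, fun i => i.elim0, fun i => i.elim0,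
        (card_filter_le _ _).trans_lt hlt⟩
    · obtain ⟨Q, hQA, hQ, hpQ⟩ := h A subset_rfl hge
      obtain ⟨r, P, hPA, hdisj, hp, hcard⟩ := ih (A \ Q) (sdiff_ssubset hQA hQ)
        (fun B hB => h B (hB.trans sdiff_subset))
      have hQP : ∀ i, Disjoint Q (P i) := fun i => disjoint_sdiff.mono_right (hPA i)
      refine ⟨r + 1, Fin.cons Q P, ?_, ?_, ?_, ?_⟩
      · exact Fin.cases hQA (fun i => (hPA i).trans sdiff_subset)
      · refine Fin.cases (Fin.cases (fun hne => absurd rfl hne) fun j _ => hQP j)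
          (fun i => Fin.cases (fun _ => (hQP i).symm) fun j hij => ?_)
        exact hdisj i j (fun e => hij (e ▸ rfl))
      · exact Fin.cases hpQ hp
      · refine lt_of_le_of_lt (card_le_card fun x hx => ?_) hcard
        rw [mem_filter] at hx
        rw [mem_filter, mem_sdiff]
        exact ⟨⟨hx.1, hx.2 0⟩, fun i => hx.2 i.succ⟩

theorem stmt14 (kss : ℕ) (V : Type) [Fintype V] (G : SimpleGraph V)
    (hG : NoTreeProp G kss) (ε : ℝ) (hε : 0 < ε ∧ ε < 1 / 2)
    (n : ℕ) (hn : (kss : ℝ) < (n : ℝ) ^ (ε ^ kss))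
    (m : ℕ → ℕ) (hm0 : m 0 ≤ n) (hlast : kss < m kss)
    (hrec : ∀ ℓ, ℓ < kss → m (ℓ + 1) = ⌊(m ℓ : ℝ) ^ ε⌋₊)
    (A : Finset V) (hA : A.card = n) :
    ∃ (istar : ℕ) (P : Fin istar → Finset V),
      (∀ i, P i ⊆ A) ∧
      (∀ i j, i ≠ j → Disjoint (P i) (P j)) ∧
      (∀ i j : Fin istar, i ≤ j → (P i).card ≤ (P j).card) ∧
      (∀ i, (∃ ℓ < kss, (P i).card = m ℓ) ∧ EpsIndivisible G ε (P i)) ∧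
      (A.filter fun a => ∀ i, a ∉ P i).card < m 0 := by
  obtain ⟨hε0, _⟩ := hε
  have hpos : ∀ ℓ ≤ kss, 0 < m ℓ := by
    intro ℓ hℓ
    induction hℓ using Nat.decreasingInduction with
    | self => omega
    | of_succ l hl ihl =>
      refine Nat.pos_of_ne_zero fun hz => ?_
      have hsucc := hrec l hl
      rw [hz, Nat.cast_zero, Real.zero_rpow hε0.ne', Nat.floor_zero] at hsucc
      omega
  have key : ∀ B ⊆ A, m 0 ≤ B.card → ∃ P ⊆ B, P.Nonempty ∧
      ((∃ ℓ < kss, P.card = m ℓ) ∧ EpsIndivisible G ε P) := by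
    intro B _ hB
    by_contra hcon
    push Not at hcon
    obtain ⟨C, hCB, hC⟩ := exists_subset_card_eq hB
    obtain ⟨a, b, -, hab⟩ := exists_tree_of_forall_not_epsIndivisible G ε kss m C
      (hpos kss le_rfl) hrec hC fun ℓ hℓ P hP hPc =>
        hcon P (hP.trans hCB) (card_pos.1 (hPc ▸ hpos ℓ hℓ.le)) ⟨ℓ, hℓ, hPc⟩
    exact hG ⟨a, b, hab⟩
  obtain ⟨r, P, hPA, hdisj, hp, hcard⟩ := exists_disjoint_family_card_lt _ (m 0) A key
  let σ := Tuple.sort fun i => (P i).card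
  refine ⟨r, P ∘ σ, fun i => hPA _, fun i j hij => hdisj _ _ (σ.injective.ne hij),
    fun i j hij => Tuple.monotone_sort (fun i => (P i).card) hij, fun i => hp _, ?_⟩
  refine lt_of_le_of_lt (card_le_card fun x hx => ?_) hcard
  rw [mem_filter] at hx ⊢
  refine ⟨hx.1, fun i => ?_⟩
  simpa using hx.2 (σ.symm i)
end

section
/- Let G be a finite graph, f, g : ℕ → ℕ∖{0}, and A, B ⊆ G with A f-indivisible, B g-indivisible, and f(|A|)·g(|B|) < |B|/2. Then there is a truth value t ∈ {0,1} such that for all but fewer than f(|A|) of the elements a ∈ A, for all but fewer than g(|B|) of the elements b ∈ B, (a R b) ≡ t. -/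
open Finset

open scoped Classical

open Paper

/-- If `B` is `g`-indivisible and each `a ∈ W` fails to have average `t` on `B`, then at most
`|W| · g(|B|)` elements `b ∈ B` satisfy `(a R b) ≡ t` for some `a ∈ W`. -/
theorem Paper.Indivisible.card_filter_exists_le {V : Type} {G : SimpleGraph V} {g : ℕ → ℕ}
    {B W : Finset V} (hB : Indivisible G g B) (t : Bool)
    (hW : ∀ a ∈ W, ¬ (B.filter fun b => ¬ (G.Adj a b ↔ t = true)).card < g B.card) :
    (B.filter fun b => ∃ a ∈ W, (G.Adj a b ↔ t = true)).card ≤ W.card * g B.card := by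
  have hsub : (B.filter fun b => ∃ a ∈ W, (G.Adj a b ↔ t = true)) ⊆
      W.biUnion fun a => B.filter fun b => (G.Adj a b ↔ t = true) := by
    intro b hb
    obtain ⟨hbB, a, haW, h⟩ := mem_filter.1 hb
    exact mem_biUnion.2 ⟨a, haW, mem_filter.2 ⟨hbB, h⟩⟩
  refine (card_le_card hsub).trans (card_biUnion_le_card_mul _ _ _ fun a ha => ?_)
  obtain ⟨s, hs⟩ := hB a
  simp only [G.adj_comm _ a] at hs
  have hst : s = !t := by
    rw [Bool.eq_not]
    rintro rfl
    exact hW a ha hs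
  subst hst
  refine le_trans (card_le_card fun b hb => ?_) hs.le
  rw [mem_filter] at hb ⊢
  refine ⟨hb.1, ?_⟩
  rw [hb.2]
  cases t <;> simp

theorem stmt15 (V : Type) [Fintype V] (G : SimpleGraph V)
    (f g : ℕ → ℕ) (hf : ∀ n, 0 < f n) (hg : ∀ n, 0 < g n)
    (A B : Finset V) (hA : Indivisible G f A) (hB : Indivisible G g B)
    (hsmall : (f A.card : ℝ) * (g B.card : ℝ) < (B.card : ℝ) / 2) :
    ∃ t : Bool,
      (A.filter fun a =>
        ¬ ((B.filter fun b => ¬ (G.Adj a b ↔ t = true)).card < g B.card)).card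
        < f A.card := by
  by_contra hnone
  have hlarge := fun t => not_lt.1 (not_exists.1 hnone t)
  choose W hWsub hWcard using fun t => exists_subset_card_eq (hlarge t)
  have hbad (t : Bool) := hB.card_filter_exists_le (W := W t) t
    fun a ha => (mem_filter.1 (hWsub t ha)).2
  have hsmall' : f A.card * g B.card + f A.card * g B.card < B.card := by
    have : (f A.card * g B.card + f A.card * g B.card : ℝ) < B.card := by linarith
    exact_mod_cast this
  obtain ⟨b, -, hb⟩ : ∃ b ∈ B, ∀ t, ∀ a ∈ W t, ¬ (G.Adj a b ↔ t = true) := by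
    by_contra! hcover
    have hBsub : B ⊆ (B.filter fun b => ∃ a ∈ W true, (G.Adj a b ↔ true = true)) ∪
        (B.filter fun b => ∃ a ∈ W false, (G.Adj a b ↔ false = true)) := by
      intro b hb
      obtain ⟨t, a, ha, h⟩ := hcover b hb
      rw [mem_union, mem_filter, mem_filter]
      cases t
      · exact Or.inr ⟨hb, a, ha, h⟩
      · exact Or.inl ⟨hb, a, ha, h⟩
    have hcard := (card_le_card hBsub).trans (card_union_le _ _)
    have htrue := hbad true
    have hfalse := hbad false
    rw [hWcard] at htrue hfalse
    omega
  obtain ⟨t, ht⟩ := hA b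
  refine absurd ht (not_lt.2 ?_)
  rw [← hWcard t]
  exact card_le_card fun a ha => mem_filter.2 ⟨(mem_filter.1 (hWsub t ha)).1, hb t a ha⟩
end

section
/- Let G be a finite graph, ζ, ε ∈ (0,1), A ⊆ G ζ-indivisible and B ⊆ G ε-indivisible, with |A|^ζ·|B|^ε < |B|/2. Let t ∈ {0,1} be a truth value such that for all but fewer than |A|^ζ of the elements a ∈ A, for all but fewer than |B|^ε of the elements b ∈ B, (a R b) ≡ t. Then for all reals ζ_1 ∈ (0, 1−ζ) and ε_1 ∈ (0, 1−ε), and all A′ ⊆ A and B′ ⊆ B with |A′| ≥ |A|^{ζ+ζ_1} and |B′| ≥ |B|^{ε+ε_1}, one has |{(a,b) ∈ A′×B′ : (a R b) ≢ t}| / (|A′|·|B′|) ≤ |A|^{−ζ_1} + |B|^{−ε_1}. -/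
open Finset

open scoped Classical

open Paper

/-- If all but at most `x` of the `a ∈ A` are related by `P` to fewer than `y` of the `b ∈ B`, then
`P` holds for at most `x * |B'| + |A'| * y` pairs of any subrectangle `A' × B'`. -/
theorem card_filter_product_le {α β : Type*} (P : α → β → Prop) {A A' : Finset α}
    {B B' : Finset β} (hA : A' ⊆ A) (hB : B' ⊆ B) {x y : ℝ} (hy : 0 ≤ y)
    (h : (#{a ∈ A | ¬ (#{b ∈ B | P a b} : ℝ) < y} : ℝ) ≤ x) :
    (#{p ∈ A' ×ˢ B' | P p.1 p.2} : ℝ) ≤ x * #B' + #A' * y := by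
  have hsum : (#{p ∈ A' ×ˢ B' | P p.1 p.2} : ℝ) = ∑ a ∈ A', (#{b ∈ B' | P a b} : ℝ) := by
    simp only [card_filter, Finset.sum_product, Nat.cast_sum]
  have hrow : ∀ a ∈ A', (#{b ∈ B' | P a b} : ℝ) ≤
      (if ¬ (#{b ∈ B | P a b} : ℝ) < y then 1 else 0) * #B' + y := by
    intro a _
    by_cases hlt : (#{b ∈ B | P a b} : ℝ) < y
    · have : (#{b ∈ B' | P a b} : ℝ) ≤ #{b ∈ B | P a b} :=
        mod_cast card_le_card (filter_subset_filter _ hB)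
      rw [if_neg (not_not.mpr hlt)]
      linarith
    · have : (#{b ∈ B' | P a b} : ℝ) ≤ #B' := mod_cast card_filter_le _ _
      rw [if_pos hlt]
      linarith
  have hbad : (#{a ∈ A' | ¬ (#{b ∈ B | P a b} : ℝ) < y} : ℝ) ≤ x :=
    le_trans (mod_cast card_le_card (filter_subset_filter _ hA)) h
  rw [hsum]
  refine (sum_le_sum hrow).trans ?_
  rw [sum_add_distrib, ← sum_mul, sum_boole, sum_const, nsmul_eq_mul]
  gcongr

/-- A set of size at least `a ^ (s + r)` is at least `a ^ r` times larger than `a ^ s`. -/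
theorem rpow_div_le_rpow_neg {a s r c : ℝ} (ha : 0 < a) (hc : a ^ (s + r) ≤ c) :
    a ^ s / c ≤ a ^ (-r) := by
  rw [div_le_iff₀ ((Real.rpow_pos_of_pos ha _).trans_le hc)]
  calc a ^ s = a ^ (-r) * a ^ (s + r) := by rw [← Real.rpow_add ha]; ring_nf
    _ ≤ a ^ (-r) * c := by gcongr

theorem stmt16 (V : Type) [Fintype V] (G : SimpleGraph V)
    (ζ ε : ℝ) (hζ : 0 < ζ ∧ ζ < 1) (hε : 0 < ε ∧ ε < 1)
    (A B : Finset V) (hA : EpsIndivisible G ζ A) (hB : EpsIndivisible G ε B)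
    (hsmall : (A.card : ℝ) ^ ζ * (B.card : ℝ) ^ ε < (B.card : ℝ) / 2)
    (t : Bool)
    (ht : ((A.filter fun a =>
        ¬ (((B.filter fun b => ¬ (G.Adj a b ↔ t = true)).card : ℝ)
            < (B.card : ℝ) ^ ε)).card : ℝ)
      < (A.card : ℝ) ^ ζ) :
    ∀ ζ1 ε1 : ℝ, 0 < ζ1 → ζ1 < 1 - ζ → 0 < ε1 → ε1 < 1 - ε →
      ∀ A' ⊆ A, ∀ B' ⊆ B,
        (A.card : ℝ) ^ (ζ + ζ1) ≤ (A'.card : ℝ) →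
        (B.card : ℝ) ^ (ε + ε1) ≤ (B'.card : ℝ) →
        (((A' ×ˢ B').filter fun p => ¬ (G.Adj p.1 p.2 ↔ t = true)).card : ℝ)
            / (A'.card * B'.card)
          ≤ (A.card : ℝ) ^ (-ζ1) + (B.card : ℝ) ^ (-ε1) := by
  intro ζ1 ε1 _ _ _ _ A' hA' B' hB' hcA hcB
  have ha : (0 : ℝ) < A.card := by
    refine (Nat.cast_nonneg _).lt_of_ne fun h0 => ?_
    rw [← h0, Real.zero_rpow hζ.1.ne'] at ht
    exact absurd ht (not_lt.mpr (Nat.cast_nonneg _))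
  have hb : (0 : ℝ) < B.card := by
    have : (0 : ℝ) ≤ (A.card : ℝ) ^ ζ * (B.card : ℝ) ^ ε := by positivity
    linarith
  have ha' : (0 : ℝ) < A'.card := (Real.rpow_pos_of_pos ha _).trans_le hcA
  have hb' : (0 : ℝ) < B'.card := (Real.rpow_pos_of_pos hb _).trans_le hcB
  have hcount := card_filter_product_le (fun a b => ¬ (G.Adj a b ↔ t = true)) hA' hB'
    (Real.rpow_nonneg hb.le ε) (x := (A.card : ℝ) ^ ζ)
    (le_of_eq_of_le (by congr!) ht.le)
  calc _ ≤ ((A.card : ℝ) ^ ζ * B'.card + A'.card * (B.card : ℝ) ^ ε)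
        / (A'.card * B'.card) := by
          gcongr
          exact le_of_eq_of_le (by congr!) hcount
    _ = (A.card : ℝ) ^ ζ / A'.card + (B.card : ℝ) ^ ε / B'.card := by field_simp
    _ ≤ _ := add_le_add (rpow_div_le_rpow_neg ha hcA) (rpow_div_le_rpow_neg hb hcB)
end

section
/- Let H be a finite graph, k ∈ ℕ, and ⟨a_i : i < α⟩ a Δ_k-indiscernible sequence of vertices of H with α ≥ 2k. Suppose there are indices i_0 < … < i_{2k−1} < α and a vertex b ∈ H such that b R a_{i_ℓ} holds for all 0 ≤ ℓ ≤ k−1 and b R a_{i_ℓ} fails for all k ≤ ℓ < 2k. Then H has the k-order property. The same conclusion holds if instead b R a_{i_ℓ} fails for all ℓ < k and holds for all k ≤ ℓ < 2k. -/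
open Finset

open scoped Classical

open Paper

/-- The `k` consecutive entries, starting at position `s`, of a sequence of length `2 * k`. -/
def window {k n s : ℕ} (hs : s ≤ k) (i : Fin (2 * k) → Fin n) (ℓ : Fin k) : Fin n :=
  i ⟨s + ℓ, by omega⟩

theorem strictMono_window {k n s : ℕ} (hs : s ≤ k) {i : Fin (2 * k) → Fin n}
    (hi : StrictMono i) : StrictMono (window hs i) := fun _ _ hxy =>
  hi (Fin.mk_lt_mk.2 (Nat.add_lt_add_left hxy s))

/-- A vertex adjacent to the first half of a sequence and to none of the second half yields, for
every `m`, a vertex adjacent to exactly the first `m` entries of the initial window. -/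
theorem exists_cut_of_adj_nonadj {V : Type} {H : SimpleGraph V} {k n : ℕ} {a : Fin n → V}
    (ha : DeltaIndiscernible H k a) {i : Fin (2 * k) → Fin n} (hi : StrictMono i) {b : V}
    (hlow : ∀ ℓ : Fin (2 * k), (ℓ : ℕ) < k → H.Adj b (a (i ℓ)))
    (hhigh : ∀ ℓ : Fin (2 * k), k ≤ (ℓ : ℕ) → ¬ H.Adj b (a (i ℓ))) (m : Fin k) :
    ∃ y : V, (∀ ℓ : Fin k, ℓ < m → H.Adj y (a (window k.zero_le i ℓ))) ∧
      ∀ ℓ : Fin k, m ≤ ℓ → ¬ H.Adj y (a (window k.zero_le i ℓ)) := by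
  refine ((ha.2.2 m m.2.le _ _ (strictMono_window (Nat.sub_le k m) hi)
    (strictMono_window k.zero_le hi)).1).1 ⟨b, fun ℓ hℓ => hlow _ ?_, fun ℓ hℓ => hhigh _ ?_⟩
  all_goals
    dsimp only
    omega

/-- A vertex adjacent to none of the first half of a sequence and to all of the second half yields,
for every `m`, a vertex nonadjacent to exactly the first `m` entries of the initial window. -/
theorem exists_cut_of_nonadj_adj {V : Type} {H : SimpleGraph V} {k n : ℕ} {a : Fin n → V}
    (ha : DeltaIndiscernible H k a) {i : Fin (2 * k) → Fin n} (hi : StrictMono i) {b : V}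
    (hlow : ∀ ℓ : Fin (2 * k), (ℓ : ℕ) < k → ¬ H.Adj b (a (i ℓ)))
    (hhigh : ∀ ℓ : Fin (2 * k), k ≤ (ℓ : ℕ) → H.Adj b (a (i ℓ))) (m : Fin k) :
    ∃ y : V, (∀ ℓ : Fin k, ℓ < m → ¬ H.Adj y (a (window k.zero_le i ℓ))) ∧
      ∀ ℓ : Fin k, m ≤ ℓ → H.Adj y (a (window k.zero_le i ℓ)) := by
  refine ((ha.2.2 m m.2.le _ _ (strictMono_window (Nat.sub_le k m) hi)
    (strictMono_window k.zero_le hi)).2).1 ⟨b, fun ℓ hℓ => hlow _ ?_, fun ℓ hℓ => hhigh _ ?_⟩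
  all_goals
    dsimp only
    omega

theorem stmt17 (k : ℕ) (V : Type) [Fintype V] (H : SimpleGraph V)
    (α : ℕ) (hα : 2 * k ≤ α) (a : Fin α → V)
    (ha : DeltaIndiscernible H k a)
    (i : Fin (2 * k) → Fin α) (hi : StrictMono i) (b : V)
    (hb : ((∀ ℓ : Fin (2 * k), (ℓ : ℕ) < k → H.Adj b (a (i ℓ))) ∧
           (∀ ℓ : Fin (2 * k), k ≤ (ℓ : ℕ) → ¬ H.Adj b (a (i ℓ)))) ∨
          ((∀ ℓ : Fin (2 * k), (ℓ : ℕ) < k → ¬ H.Adj b (a (i ℓ))) ∧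
           (∀ ℓ : Fin (2 * k), k ≤ (ℓ : ℕ) → H.Adj b (a (i ℓ))))) :
    HasOrderProp H k := by
  rcases hb with ⟨hlow, hhigh⟩ | ⟨hlow, hhigh⟩
  · choose y hlt hge using exists_cut_of_adj_nonadj ha hi hlow hhigh
    exact ⟨fun ℓ => a (window k.zero_le i ℓ), y, fun p q hpq =>
      ⟨(hlt q p hpq).symm, fun h => hge p q hpq.le h.symm⟩⟩
  · choose y hlt hge using exists_cut_of_nonadj_adj ha hi hlow hhigh
    exact ⟨y, fun ℓ => a (window k.zero_le i ℓ), fun p q hpq =>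
      ⟨hge p q hpq.le, hlt q p hpq⟩⟩
end

section
/- Let k* ∈ ℕ, let G be a finite graph with the non-k*-order property, let m ≥ 4k*, let ⟨a_i : i < m⟩ be a Δ_{k*}-indiscernible sequence of vertices of G, and let b ∈ G. Then |{i < m : a_i R b}| < 2k* or |{i < m : ¬(a_i R b)}| < 2k*. -/
open Finset

open scoped Classical

open Paper

/-- Two increasing sequences of length `2 * k`, the first of which is no later than the second at
position `k - 1`, can be spliced: the first half of `f` lies below the second half of `g`. -/
theorem strictMono_splice {α : Type*} [LinearOrder α] {k : ℕ} {f g : Fin (2 * k) → α}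
    (hf : StrictMono f) (hg : StrictMono g)
    (h : ∀ i j : Fin (2 * k), (i : ℕ) + 1 = k → (j : ℕ) + 1 = k → f i ≤ g j) (n : ℕ) :
    StrictMono fun l : Fin k =>
      if (l : ℕ) < n then f ⟨l, by omega⟩ else g ⟨k + l, by omega⟩ := by
  intro x y hxy
  have hxy' : (x : ℕ) < y := hxy
  dsimp only
  split_ifs with hx hy hy
  · exact hf hxy'
  · calc f ⟨x, by omega⟩ ≤ f ⟨k - 1, by omega⟩ := hf.monotone (Fin.mk_le_mk.2 (by omega))
      _ ≤ g ⟨k - 1, by omega⟩ := h _ _ (Nat.sub_add_cancel (by omega)) (Nat.sub_add_cancel (by omega))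
      _ < g ⟨k + y, by omega⟩ := hg (Fin.mk_lt_mk.2 (by omega))
  · omega
  · exact hg (Fin.mk_lt_mk.2 (by omega))

theorem hasOrderProp_of_adj_initial {V : Type} {G : SimpleGraph V} {k : ℕ} (c : Fin k → V)
    (h : ∀ n ≤ k, ∃ y : V, (∀ l : Fin k, (l : ℕ) < n → G.Adj y (c l)) ∧
      ∀ l : Fin k, n ≤ (l : ℕ) → ¬ G.Adj y (c l)) : HasOrderProp G k := by
  choose y hy using fun n : Fin k => h n n.2.le
  exact ⟨c, y, fun i j hij =>
    ⟨((hy j).1 i hij).symm, fun hadj => (hy i).2 j (le_of_lt hij) hadj.symm⟩⟩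

theorem hasOrderProp_of_adj_final {V : Type} {G : SimpleGraph V} {k : ℕ} (c : Fin k → V)
    (h : ∀ n ≤ k, ∃ y : V, (∀ l : Fin k, (l : ℕ) < n → ¬ G.Adj y (c l)) ∧
      ∀ l : Fin k, n ≤ (l : ℕ) → G.Adj y (c l)) : HasOrderProp G k := by
  choose y hy using fun n : Fin k => h (k - n) (Nat.sub_le _ _)
  refine ⟨fun i => c i.rev, y, fun i j hij => ?_⟩
  have hij' : (i : ℕ) < j := hij
  refine ⟨((hy j).2 i.rev ?_).symm, fun hadj => (hy i).1 j.rev ?_ hadj.symm⟩ <;>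
    rw [Fin.val_rev] <;> omega

theorem stmt18 (ks : ℕ) (V : Type) [Fintype V] (G : SimpleGraph V)
    (hG : NoOrderProp G ks) (m : ℕ) (hm : 4 * ks ≤ m)
    (a : Fin m → V) (ha : DeltaIndiscernible G ks a) (b : V) :
    (Finset.univ.filter fun i : Fin m => G.Adj (a i) b).card < 2 * ks ∨
    (Finset.univ.filter fun i : Fin m => ¬ G.Adj (a i) b).card < 2 * ks := by
  by_contra! hcon
  obtain ⟨hpos, hneg⟩ := hcon
  set f := Finset.orderEmbOfCardLe _ hpos
  set g := Finset.orderEmbOfCardLe _ hneg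
  have hf (i) : G.Adj b (a (f i)) :=
    (Finset.mem_filter.1 (Finset.orderEmbOfCardLe_mem _ hpos i)).2.symm
  have hg (i) : ¬ G.Adj b (a (g i)) := fun h =>
    (Finset.mem_filter.1 (Finset.orderEmbOfCardLe_mem _ hneg i)).2 h.symm
  have hj : StrictMono (Fin.castLE (by omega) : Fin ks → Fin m) := Fin.strictMono_castLE _
  by_cases hle : ∀ i j : Fin (2 * ks), (i : ℕ) + 1 = ks → (j : ℕ) + 1 = ks → f i ≤ g j
  · refine hG (hasOrderProp_of_adj_initial (fun l => a (Fin.castLE (by omega) l)) fun n hn => ?_)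
    refine (ha.2.2 n hn _ _ (strictMono_splice f.strictMono g.strictMono hle n) hj).1.1
      ⟨b, fun l hl => ?_, fun l hl => ?_⟩
    · rw [if_pos hl]
      exact hf _
    · rw [if_neg hl.not_gt]
      exact hg _
  · have hle' : ∀ i j : Fin (2 * ks), (i : ℕ) + 1 = ks → (j : ℕ) + 1 = ks → g i ≤ f j := by
      push Not at hle
      obtain ⟨i, j, hi, hj, hlt⟩ := hle
      intro i' j' hi' hj'
      obtain rfl : i' = j := Fin.ext (by omega)
      obtain rfl : j' = i := Fin.ext (by omega)
      exact hlt.le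
    refine hG (hasOrderProp_of_adj_final (fun l => a (Fin.castLE (by omega) l)) fun n hn => ?_)
    refine (ha.2.2 n hn _ _ (strictMono_splice g.strictMono f.strictMono hle' n) hj).2.1
      ⟨b, fun l hl => ?_, fun l hl => ?_⟩
    · rw [if_pos hl]
      exact hg _
    · rw [if_neg hl.not_gt]
      exact hf _
end

section
/- Let k* ∈ ℕ and let G be a finite graph with the non-k*-order property. Let ⟨a_i : i < s_1⟩ and ⟨b_j : j < s_2⟩ be Δ_{k*}-indiscernible sequences of vertices of G with s_1 ≥ 2k* and s_2 > (2k*)². Let U = {i < s_1 : |{j < s_2 : a_i R b_j}| ≥ 2k*}. Then |U| ≤ 2k* or |U| ≥ s_1 − 2k*. -/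
open Finset

open scoped Classical

open Paper

/-- Two disjoint large sets of indices contain an increasing sequence
whose first half lies in one of them and whose second half lies in the other. -/
theorem exists_strictMono_split {n k : ℕ} (S T : Finset (Fin n)) (hST : Disjoint S T)
    (hS : 2 * k ≤ S.card) (hT : 2 * k ≤ T.card) :
    ∃ f : Fin (2 * k) → Fin n, StrictMono f ∧
      ((∀ l : Fin (2 * k), ((l : ℕ) < k → f l ∈ S) ∧ (k ≤ (l : ℕ) → f l ∈ T)) ∨
        (∀ l : Fin (2 * k), ((l : ℕ) < k → f l ∈ T) ∧ (k ≤ (l : ℕ) → f l ∈ S))) := by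
  rcases Nat.eq_zero_or_pos k with rfl | hk
  · exact ⟨fun l => absurd l.2 (by simp), fun l => absurd l.2 (by simp),
      Or.inl fun l => absurd l.2 (by simp)⟩
  have aux : ∀ (S T : Finset (Fin n)) (e g : Fin (2 * k) → Fin n), StrictMono e → StrictMono g →
      (∀ l, e l ∈ S) → (∀ l, g l ∈ T) → e ⟨k - 1, by omega⟩ < g ⟨k - 1, by omega⟩ →
      ∃ f : Fin (2 * k) → Fin n, StrictMono f ∧
        (∀ l : Fin (2 * k), ((l : ℕ) < k → f l ∈ S) ∧ (k ≤ (l : ℕ) → f l ∈ T)) := by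
    intro S T e g he hg heS hgT hlt
    refine ⟨fun l => if (l : ℕ) < k then e l else g l, fun x y hxy => ?_, fun l => ⟨?_, ?_⟩⟩
    · have hxy' : (x : ℕ) < y := hxy
      by_cases hx : (x : ℕ) < k <;> by_cases hy : (y : ℕ) < k
      · simpa [hx, hy] using he hxy
      · simp only [hx, hy, if_true, if_false]
        refine lt_of_le_of_lt (he.monotone ?_) (hlt.trans (hg ?_))
        · exact Fin.mk_le_mk.2 (by omega)
        · exact Fin.mk_lt_mk.2 (by omega)
      · omega
      · simpa [hx, hy] using hg hxy
    · intro h; simpa [h] using heS l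
    · intro h; simpa [not_lt.2 h] using hgT l
  obtain ⟨S', hS', hSc⟩ := Finset.exists_subset_card_eq hS
  obtain ⟨T', hT', hTc⟩ := Finset.exists_subset_card_eq hT
  have heS := fun l => hS' (Finset.orderEmbOfFin_mem S' hSc l)
  have hgT := fun l => hT' (Finset.orderEmbOfFin_mem T' hTc l)
  have he := (S'.orderEmbOfFin hSc).strictMono
  have hg := (T'.orderEmbOfFin hTc).strictMono
  rcases lt_trichotomy (S'.orderEmbOfFin hSc ⟨k - 1, by omega⟩)
    (T'.orderEmbOfFin hTc ⟨k - 1, by omega⟩) with h | h | h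
  · obtain ⟨f, hf, hfl⟩ := aux S T _ _ he hg heS hgT h
    exact ⟨f, hf, Or.inl hfl⟩
  · exact absurd h (Finset.disjoint_iff_ne.1 hST _ (heS _) _ (hgT _))
  · obtain ⟨f, hf, hfl⟩ := aux T S _ _ hg he hgT heS h
    exact ⟨f, hf, Or.inr hfl⟩

/-- Without the order property, no vertex separates the first half of an increasing subsequence
of an indiscernible sequence from its second half. -/
theorem not_adj_split {V : Type} {G : SimpleGraph V} {k n : ℕ} (hG : NoOrderProp G k)
    {c : Fin n → V} (hc : DeltaIndiscernible G k c) {f : Fin (2 * k) → Fin n}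
    (hf : StrictMono f) (y : V) :
    (¬ ∀ l : Fin (2 * k),
        ((l : ℕ) < k → G.Adj y (c (f l))) ∧ (k ≤ (l : ℕ) → ¬ G.Adj y (c (f l)))) ∧
      ¬ ∀ l : Fin (2 * k),
        ((l : ℕ) < k → ¬ G.Adj y (c (f l))) ∧ (k ≤ (l : ℕ) → G.Adj y (c (f l))) := by
  let w : ℕ → Fin k → Fin n := fun m l => f ⟨l + (k - m), by omega⟩
  have hw : ∀ m, StrictMono (w m) := fun m x z hxz => hf (by
    have : (x : ℕ) < z := hxz
    exact Fin.mk_lt_mk.2 (by omega))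
  constructor
  · intro h
    have H : ∀ m : Fin k, ∃ z : V, (∀ l : Fin k, (l : ℕ) < m → G.Adj z (c (w k l))) ∧
        ∀ l : Fin k, (m : ℕ) ≤ l → ¬ G.Adj z (c (w k l)) := fun m =>
      (hc.2.2 m m.2.le (w m) (w k) (hw m) (hw k)).1.1
        ⟨y, fun l hl => (h _).1 (by dsimp only; omega), fun l hl => (h _).2 (by dsimp only; omega)⟩
    choose z hz hz' using H
    exact hG ⟨fun l => c (w k l), z, fun i j hij =>
      ⟨(hz j i hij).symm, fun hadj => hz' i j (le_of_lt hij) hadj.symm⟩⟩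
  · intro h
    have H : ∀ m : Fin k, ∃ z : V, (∀ l : Fin k, (l : ℕ) < m → ¬ G.Adj z (c (w k l))) ∧
        ∀ l : Fin k, (m : ℕ) ≤ l → G.Adj z (c (w k l)) := fun m =>
      (hc.2.2 m m.2.le (w m) (w k) (hw m) (hw k)).2.1
        ⟨y, fun l hl => (h _).1 (by dsimp only; omega), fun l hl => (h _).2 (by dsimp only; omega)⟩
    choose z hz hz' using H
    exact hG ⟨z, fun l => c (w k l), fun i j hij => ⟨hz' i j (le_of_lt hij), hz j i hij⟩⟩

/-- If a set of indices and its complement are both large, then some `2 * k` indices witness that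
no vertex has that set as its neighbourhood in an indiscernible sequence. -/
theorem exists_card_le_not_trace {V : Type} {G : SimpleGraph V} {k n : ℕ}
    (hG : NoOrderProp G k) {c : Fin n → V} (hc : DeltaIndiscernible G k c) (S : Finset (Fin n))
    (hS : 2 * k ≤ S.card) (hS' : 2 * k ≤ Sᶜ.card) :
    ∃ T : Finset (Fin n), T.card ≤ 2 * k ∧ ∀ y, ¬ ∀ i ∈ T, (G.Adj y (c i) ↔ i ∈ S) := by
  obtain ⟨f, hf, hfS⟩ := exists_strictMono_split S Sᶜ disjoint_compl_right hS hS'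
  refine ⟨Finset.univ.image f, by simpa using Finset.card_image_le (s := Finset.univ) (f := f),
    fun y hy => ?_⟩
  have hy' : ∀ l, G.Adj y (c (f l)) ↔ f l ∈ S := fun l => hy _ (by simp)
  rcases hfS with h | h
  · exact (not_adj_split hG hc hf y).1 fun l => by simpa [hy'] using h l
  · exact (not_adj_split hG hc hf y).2 fun l => by simpa [hy'] using h l

/-- A vertex has few neighbours or few non-neighbours in an indiscernible sequence. -/
theorem card_adj_lt_or_card_not_adj_lt {V : Type} {G : SimpleGraph V} {k n : ℕ}
    (hG : NoOrderProp G k) {c : Fin n → V} (hc : DeltaIndiscernible G k c) (y : V) :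
    (Finset.univ.filter fun i => G.Adj y (c i)).card < 2 * k ∨
      (Finset.univ.filter fun i => ¬ G.Adj y (c i)).card < 2 * k := by
  by_contra! h
  obtain ⟨T, -, hT⟩ := exists_card_le_not_trace hG hc _ h.1 (by rw [Finset.compl_filter]; exact h.2)
  exact hT y fun i _ => by simp

theorem stmt19 (ks : ℕ) (V : Type) [Fintype V] (G : SimpleGraph V)
    (hG : NoOrderProp G ks) (s1 s2 : ℕ) (hs1 : 2 * ks ≤ s1) (hs2 : (2 * ks) ^ 2 < s2)
    (a : Fin s1 → V) (b : Fin s2 → V)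
    (ha : DeltaIndiscernible G ks a) (hb : DeltaIndiscernible G ks b) :
    (Finset.univ.filter fun i : Fin s1 =>
        2 * ks ≤ (Finset.univ.filter fun j : Fin s2 => G.Adj (a i) (b j)).card).card
      ≤ 2 * ks ∨
    s1 - 2 * ks ≤
      (Finset.univ.filter fun i : Fin s1 =>
        2 * ks ≤ (Finset.univ.filter fun j : Fin s2 => G.Adj (a i) (b j)).card).card := by
  by_contra! h
  set U := Finset.univ.filter fun i : Fin s1 =>
    2 * ks ≤ (Finset.univ.filter fun j : Fin s2 => G.Adj (a i) (b j)).card with hU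
  have hUc : 2 * ks ≤ Uᶜ.card := by
    rw [Finset.card_compl, Fintype.card_fin]
    omega
  obtain ⟨T, hTc, hT⟩ := exists_card_le_not_trace hG ha U h.1.le hUc
  let bad : Fin s1 → Finset (Fin s2) := fun i =>
    Finset.univ.filter fun j => ¬ (G.Adj (a i) (b j) ↔ i ∈ U)
  have hbad : ∀ i, (bad i).card ≤ 2 * ks := by
    intro i
    by_cases hi : i ∈ U
    · have hi' := hi
      simp only [hU, Finset.mem_filter, Finset.mem_univ, true_and] at hi'
      rcases card_adj_lt_or_card_not_adj_lt hG hb (a i) with h' | h'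
      · omega
      · simpa [bad, hi] using h'.le
    · have hi' := hi
      simp only [hU, Finset.mem_filter, Finset.mem_univ, true_and, not_le] at hi'
      simpa [bad, hi] using hi'.le
  have hcard : (T.biUnion bad).card < s2 := by
    calc (T.biUnion bad).card ≤ T.card * (2 * ks) :=
          Finset.card_biUnion_le_card_mul _ _ _ fun i _ => hbad i
      _ ≤ 2 * ks * (2 * ks) := Nat.mul_le_mul_right _ hTc
      _ < s2 := by rwa [← sq]
  obtain ⟨j, -, hj⟩ := Finset.exists_mem_notMem_of_card_lt_card
    (s := T.biUnion bad) (t := Finset.univ) (by simpa using hcard)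
  refine hT (b j) fun i hi => ?_
  by_contra hne
  refine hj (Finset.mem_biUnion.2 ⟨i, hi, Finset.mem_filter.2 ⟨Finset.mem_univ _, ?_⟩⟩)
  rwa [G.adj_comm]
end
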